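/- arXiv:0901.2008 — 2 statements merged into one kernel-verified Lean document; each statement's English description precedes it below -/
import Mathlib

section
/- For n ≥ 2, the number of pairs (u,v) of n-cycles in the symmetric group S_n such that 1 and 2 lie in the same cycle of the product uv equals ((n-1)!)^2 times (1/2 if n is odd, and 1/2 - 2/((n-1)(n+2)) if n is even). -/
open Equiv Finset Classical
noncomputable section
attribute [local instance] Classical.propDecidable

section

variable {α : Type*}

/-- All points lie in a single cycle. -/
def IsFullCycle (v : Perm α) : Prop := ∀ i j, v.SameCycle i j

abbrev Stabilizes (S : Finset α) (v : Perm α) : Prop := ∀ x, v x ∈ S ↔ x ∈ S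

/-- The sign of the restriction of `v` to `S`, or `0` if `v` does not stabilize `S`. -/
def restrictSign (S : Finset α) (v : Perm α) : ℚ :=
  if h : Stabilizes S v then ((Perm.sign (v.subtypePerm (p := (· ∈ S)) h) : ℤ) : ℚ) else 0

theorem restrictSign_of_not {S : Finset α} {v : Perm α} (h : ¬ Stabilizes S v) :
    restrictSign S v = 0 := dif_neg h

theorem restrictSign_of_stabilizes {S : Finset α} {v : Perm α} (h : Stabilizes S v) :
    restrictSign S v = ((Perm.sign (v.subtypePerm (p := (· ∈ S)) h) : ℤ) : ℚ) := dif_pos h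

theorem Stabilizes.mul {S : Finset α} {u v : Perm α} (hu : Stabilizes S u) (hv : Stabilizes S v) :
    Stabilizes S (u * v) := fun x => (hu _).trans (hv x)

theorem Stabilizes.inv {S : Finset α} {u : Perm α} (hu : Stabilizes S u) :
    Stabilizes S u⁻¹ := fun x => by
  have := hu (u⁻¹ x)
  rw [show u (u⁻¹ x) = x by simp] at this
  exact this.symm

theorem restrictSign_mul {S : Finset α} {u : Perm α} (hu : Stabilizes S u) (v : Perm α) :
    restrictSign S (u * v) = restrictSign S u * restrictSign S v := by
  by_cases hv : Stabilizes S v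
  · rw [restrictSign_of_stabilizes hu, restrictSign_of_stabilizes hv,
      restrictSign_of_stabilizes (hu.mul hv), ← Int.cast_mul, ← Units.val_mul, ← Perm.sign_mul]
    rfl
  · rw [restrictSign_of_not hv, mul_zero, restrictSign_of_not]
    intro h
    apply hv
    have := hu.inv.mul h
    rwa [inv_mul_cancel_left] at this

theorem restrictSign_inv {S : Finset α} {u : Perm α} (hu : Stabilizes S u) :
    restrictSign S u⁻¹ = restrictSign S u := by
  rw [restrictSign_of_stabilizes hu, restrictSign_of_stabilizes hu.inv, ← Perm.sign_inv]
  rfl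

theorem restrictSign_empty (v : Perm α) : restrictSign ∅ v = 1 := by
  have h : Stabilizes ∅ v := fun x => by simp
  rw [restrictSign_of_stabilizes h,
    Subsingleton.elim (v.subtypePerm (p := (· ∈ (∅ : Finset α))) h) 1]
  simp

theorem stabilizes_swap_mem {S : Finset α} {x y : α} (hx : x ∈ S) (hy : y ∈ S) :
    Stabilizes S (swap x y) := fun z => by
  rw [swap_apply_def]
  split_ifs <;> simp_all

theorem stabilizes_swap_notMem {S : Finset α} {x y : α} (hx : x ∉ S) (hy : y ∉ S) :
    Stabilizes S (swap x y) := fun z => by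
  rw [swap_apply_def]
  split_ifs <;> simp_all

theorem restrictSign_swap_notMem {S : Finset α} {x y : α} (hx : x ∉ S) (hy : y ∉ S) :
    restrictSign S (swap x y) = 1 := by
  have h := stabilizes_swap_notMem hx hy
  have : (swap x y).subtypePerm (p := (· ∈ S)) h = 1 := by
    ext ⟨z, hz⟩
    simp only [Perm.subtypePerm_apply, Perm.coe_one, id_eq]
    exact swap_apply_of_ne_of_ne (by rintro rfl; exact hx hz) (by rintro rfl; exact hy hz)
  rw [restrictSign_of_stabilizes h, this]
  simp

theorem IsFullCycle.not_stabilizes {v : Perm α} (hv : IsFullCycle v) {S : Finset α} {x y : α}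
    (hx : x ∈ S) (hy : y ∉ S) : ¬ Stabilizes S v := by
  intro h
  obtain ⟨k, hk⟩ := hv x y
  have : ∀ k : ℤ, ((v ^ k) x ∈ S ↔ x ∈ S) := by
    intro k
    induction k using Int.induction_on with
    | zero => simp
    | succ i ih =>
      rw [add_comm, zpow_add, zpow_one, Perm.mul_apply, h, ih]
    | pred i ih =>
      rw [sub_eq_neg_add, zpow_add, zpow_neg_one, Perm.mul_apply, h.inv, ih]
  exact hy (hk ▸ (this k).2 hx)

theorem Perm.SameCycle.of_apply {v : Perm α} {r : α → α → Prop} (hr : Equivalence r)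
    (h : ∀ i, r i (v i)) {i j : α} (hij : v.SameCycle i j) : r i j := by
  obtain ⟨k, rfl⟩ := hij
  induction k using Int.induction_on with
  | zero => exact hr.refl _
  | succ k ih =>
    rw [add_comm, zpow_add, zpow_one, Perm.mul_apply]
    exact hr.trans ih (h _)
  | pred k ih =>
    rw [sub_eq_neg_add, zpow_add, zpow_neg_one, Perm.mul_apply]
    refine hr.trans ih (hr.symm ?_)
    have := h (v⁻¹ ((v ^ (-(k : ℤ))) i))
    rwa [show ∀ z, v (v⁻¹ z) = z by simp] at this

theorem equivalence_sameCycle (v : Perm α) : Equivalence v.SameCycle :=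
  ⟨Perm.SameCycle.refl v, Perm.SameCycle.symm, Perm.SameCycle.trans⟩

theorem stabilizes_iff_exists {S : Finset α} {w : Perm α} :
    Stabilizes S w ↔ ∃ (p : Perm {x // x ∈ S}) (q : Perm {x // x ∉ S}),
      Perm.subtypeCongr p q = w := by
  constructor
  · intro h
    refine ⟨w.subtypePerm h, w.subtypePerm (p := (· ∉ S)) fun x => not_congr (h x), ?_⟩
    ext x
    by_cases hx : x ∈ S
    · rw [Perm.subtypeCongr.left_apply _ _ hx]; rfl
    · rw [Perm.subtypeCongr.right_apply _ _ hx]; rfl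
  · rintro ⟨p, q, rfl⟩ x
    by_cases hx : x ∈ S
    · rw [Perm.subtypeCongr.left_apply _ _ hx]
      simp [hx]
    · rw [Perm.subtypeCongr.right_apply _ _ hx]
      simpa [hx] using (q ⟨x, hx⟩).2

/-- A sum over subsets to which only the empty set and singletons contribute. -/
theorem sum_powerset_of_card_le_one (T : Finset α) (g : Finset α → ℚ)
    (hg : ∀ S ⊆ T, 1 < S.card → g S = 0) :
    ∑ S ∈ T.powerset, g S = g ∅ + ∑ z ∈ T, g {z} := by
  have h : insert ∅ (T.map ⟨singleton, Finset.singleton_injective⟩) ⊆ T.powerset := by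
    intro S hS
    simp only [Finset.mem_insert, Finset.mem_map, Function.Embedding.coeFn_mk] at hS
    rcases hS with rfl | ⟨z, hz, rfl⟩ <;> simp_all
  rw [← Finset.sum_subset h, Finset.sum_insert, Finset.sum_map]
  · rfl
  · simp
  · intro S hS hS'
    apply hg S (Finset.mem_powerset.1 hS)
    by_contra hcard
    apply hS'
    rcases Nat.le_one_iff_eq_zero_or_eq_one.1 (not_lt.1 hcard) with h0 | h1
    · simp [Finset.card_eq_zero.1 h0]
    · obtain ⟨z, rfl⟩ := Finset.card_eq_one.1 h1
      simp_all

theorem stabilizes_subtypeCongr {S : Finset α} (p : Perm {x // x ∈ S}) (q : Perm {x // x ∉ S}) :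
    Stabilizes S (Perm.subtypeCongr p q) :=
  stabilizes_iff_exists.2 ⟨p, q, rfl⟩

theorem Stabilizes.mem_iff {S : Finset α} {v : Perm α} (h : Stabilizes S v) {i j : α}
    (hij : v.SameCycle i j) : i ∈ S ↔ j ∈ S :=
  Perm.SameCycle.of_apply (r := fun i j => i ∈ S ↔ j ∈ S)
    ⟨fun _ => Iff.rfl, Iff.symm, Iff.trans⟩ (fun i => (h i).symm) hij

theorem stabilizes_of_mapsTo {S : Finset α} {v : Perm α} (h : ∀ x ∈ S, v x ∈ S) :
    Stabilizes S v := by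
  have himage : S.image v = S := by
    refine Finset.eq_of_subset_of_card_le ?_ ?_
    · intro y hy
      obtain ⟨x, hx, rfl⟩ := Finset.mem_image.1 hy
      exact h x hx
    · rw [Finset.card_image_of_injective _ v.injective]
  intro x
  refine ⟨fun hx => ?_, h x⟩
  rw [← himage] at hx
  obtain ⟨y, hy, hyx⟩ := Finset.mem_image.1 hx
  exact v.injective hyx ▸ hy

theorem restrictSign_mul_self {S : Finset α} {v : Perm α} (h : Stabilizes S v) :
    restrictSign S v * restrictSign S v = 1 := by
  rw [restrictSign_of_stabilizes h, ← Int.cast_mul, ← Units.val_mul, Int.units_mul_self]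
  simp

theorem IsFullCycle.conj {u : Perm α} (hu : IsFullCycle u) (t : Perm α) :
    IsFullCycle (t * u * t⁻¹) := fun i j => by
  rw [Perm.sameCycle_conj]
  exact hu _ _

theorem isFullCycle_conj_iff (u t : Perm α) : IsFullCycle (t * u * t⁻¹) ↔ IsFullCycle u := by
  refine ⟨fun h => ?_, fun h => h.conj t⟩
  have := h.conj t⁻¹
  simpa [mul_assoc] using this

theorem Stabilizes.eq_of_swap_mul {S : Finset α} {w : Perm α} {x y z : α} (hx : x ∈ S)
    (hw : Stabilizes S (swap x y * w)) (hz : z ∈ S) (hwz : w z ∉ S) : w z = y := by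
  by_contra h
  have := (hw z).2 hz
  rw [Perm.mul_apply, swap_apply_of_ne_of_ne (fun h => hwz (by rwa [h])) h] at this
  exact hwz this

theorem not_stabilizes_swap {S : Finset α} {x y : α} (hx : x ∈ S) (hy : y ∉ S) :
    ¬ Stabilizes S (swap x y) := fun h => by
  have := (h x).2 hx
  rw [swap_apply_left] at this
  exact hy this

theorem restrictSign_subtypeCongr {S : Finset α} (p : Perm {x // x ∈ S})
    (q : Perm {x // x ∉ S}) :
    restrictSign S (Perm.subtypeCongr p q) = ((Perm.sign p : ℤ) : ℚ) := by
  have h := stabilizes_subtypeCongr p q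
  rw [restrictSign_of_stabilizes h]
  congr 3
  ext ⟨x, hx⟩
  rw [Perm.subtypePerm_apply]
  simp only [Perm.subtypeCongr.left_apply _ _ hx]

theorem sameCycle_subtypeCongr_left {S : Finset α} (p : Perm {x // x ∈ S})
    (q : Perm {x // x ∉ S}) {i j : α} (hi : i ∈ S) (hj : j ∈ S) :
    (Perm.subtypeCongr p q).SameCycle i j ↔ p.SameCycle ⟨i, hi⟩ ⟨j, hj⟩ := by
  have h : (Perm.subtypeCongr p q).subtypePerm (p := (· ∈ S)) (stabilizes_subtypeCongr p q) = p := by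
    ext ⟨x, hx⟩
    rw [Perm.subtypePerm_apply]
    simp only [Perm.subtypeCongr.left_apply _ _ hx]
  rw [← Perm.sameCycle_subtypePerm (h := stabilizes_subtypeCongr p q) (x := ⟨i, hi⟩)
    (y := ⟨j, hj⟩), h]

theorem sameCycle_subtypeCongr_right {S : Finset α} (p : Perm {x // x ∈ S})
    (q : Perm {x // x ∉ S}) {i j : α} (hi : i ∉ S) (hj : j ∉ S) :
    (Perm.subtypeCongr p q).SameCycle i j ↔ q.SameCycle ⟨i, hi⟩ ⟨j, hj⟩ := by
  have hs : ∀ x, Perm.subtypeCongr p q x ∉ S ↔ x ∉ S :=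
    fun x => not_congr (stabilizes_subtypeCongr p q x)
  have h : (Perm.subtypeCongr p q).subtypePerm (p := (· ∉ S)) hs = q := by
    ext ⟨x, hx⟩
    rw [Perm.subtypePerm_apply]
    simp only [Perm.subtypeCongr.right_apply _ _ hx]
  rw [← Perm.sameCycle_subtypePerm (h := hs) (p := (· ∉ S)) (x := ⟨i, hi⟩)
    (y := ⟨j, hj⟩), h]

variable [Fintype α]

theorem restrictSign_swap_mem {S : Finset α} {x y : α} (hx : x ∈ S) (hy : y ∈ S) (hxy : x ≠ y) :
    restrictSign S (swap x y) = -1 := by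
  have hmove : ∀ z, swap x y z ≠ z → z ∈ S := by
    intro z hz
    by_contra h
    exact hz (swap_apply_of_ne_of_ne (by rintro rfl; exact h hx) (by rintro rfl; exact h hy))
  have hsign : Perm.sign ((swap x y).subtypePerm (p := (· ∈ S)) (stabilizes_swap_mem hx hy)) =
      -1 := by
    rw [← Perm.sign_swap hxy]
    convert Perm.sign_subtypePerm (swap x y) (stabilizes_swap_mem hx hy) hmove
  rw [restrictSign_of_stabilizes (stabilizes_swap_mem hx hy), hsign]
  simp

theorem restrictSign_union {S C : Finset α} (hd : Disjoint S C) {v : Perm α}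
    (hS : Stabilizes S v) (hC : Stabilizes C v) :
    restrictSign (S ∪ C) v = restrictSign S v * restrictSign C v := by
  have hSC : Stabilizes (S ∪ C) v := fun x => by simp [hS x, hC x]
  rw [restrictSign_of_stabilizes hS, restrictSign_of_stabilizes hC,
    restrictSign_of_stabilizes hSC, ← Int.cast_mul, ← Units.val_mul,
    ← Perm.sign_ofSubtype (v.subtypePerm (p := (· ∈ S)) hS),
    ← Perm.sign_ofSubtype (v.subtypePerm (p := (· ∈ C)) hC),
    ← Perm.sign_ofSubtype (v.subtypePerm (p := (· ∈ S ∪ C)) hSC), ← Perm.sign_mul]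
  congr 3
  ext x
  rw [Perm.mul_apply]
  by_cases hx : x ∈ S
  · have hx' : x ∉ C := Finset.disjoint_left.1 hd hx
    rw [Perm.ofSubtype_apply_of_not_mem (p := (· ∈ C)) _ hx',
      Perm.ofSubtype_apply_of_mem (p := (· ∈ S)) _ hx,
      Perm.ofSubtype_apply_of_mem (p := (· ∈ S ∪ C)) _ (Finset.mem_union_left _ hx)]
    rfl
  · by_cases hx' : x ∈ C
    · rw [Perm.ofSubtype_apply_of_mem (p := (· ∈ C)) _ hx',
        Perm.ofSubtype_apply_of_mem (p := (· ∈ S ∪ C)) _ (Finset.mem_union_right _ hx'),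
        Perm.ofSubtype_apply_of_not_mem (p := (· ∈ S))]
      · rfl
      · exact fun h => hx ((hS x).1 h)
    · rw [Perm.ofSubtype_apply_of_not_mem (p := (· ∈ C)) _ hx',
        Perm.ofSubtype_apply_of_not_mem (p := (· ∈ S)) _ hx,
        Perm.ofSubtype_apply_of_not_mem (p := (· ∈ S ∪ C))]
      simp [hx, hx']

theorem IsFullCycle.sign [DecidableEq α] [Nonempty α] {p : Perm α} (hp : IsFullCycle p) :
    ((Perm.sign p : ℤ) : ℚ) = (-1) ^ (Fintype.card α - 1) := by
  rcases subsingleton_or_nontrivial α with h | h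
  · rw [Subsingleton.elim p 1]
    have := Fintype.card_le_one_iff_subsingleton.2 h
    simp [Nat.sub_eq_zero_of_le this]
  · have hmove : ∀ x, p x ≠ x := by
      intro x hx
      obtain ⟨y, hy⟩ := exists_ne x
      exact hy ((hp x y).eq_of_left hx).symm
    obtain ⟨x⟩ := ‹Nonempty α›
    have hc : p.IsCycle := ⟨x, hmove x, fun y _ => hp x y⟩
    have hs : p.support = Finset.univ := by ext y; simp [hmove y]
    rw [hc.sign, hs, Finset.card_univ]
    obtain ⟨k, hk⟩ : ∃ k, Fintype.card α = k + 1 :=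
      Nat.exists_eq_succ_of_ne_zero (Fintype.card_pos_iff.2 ⟨x⟩).ne'
    rw [hk]
    simp [pow_succ]

theorem isFullCycle_iff [DecidableEq α] [Nontrivial α] {p : Perm α} :
    IsFullCycle p ↔ p.IsCycle ∧ p.support = Finset.univ := by
  constructor
  · intro hp
    have hmove : ∀ x, p x ≠ x := by
      intro x hx
      obtain ⟨y, hy⟩ := exists_ne x
      exact hy ((hp x y).eq_of_left hx).symm
    obtain ⟨x, -⟩ := exists_pair_ne α
    exact ⟨⟨x, hmove x, fun y _ => hp x y⟩, by ext y; simp [hmove y]⟩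
  · rintro ⟨hc, hs⟩ i j
    have h : ∀ x, p x ≠ x := fun x => by
      rw [← Perm.mem_support, hs]; exact Finset.mem_univ _
    exact hc.sameCycle (h i) (h j)

theorem sum_restrictSign_powerset (a : α) (v : Perm α) :
    ∑ S ∈ (Finset.univ.erase a).powerset, (-1) ^ S.card * restrictSign S v =
      if IsFullCycle v then 1 else 0 := by
  split_ifs with hv
  · rw [Finset.sum_eq_single ∅]
    · simp [restrictSign_empty]
    · intro S hS hne
      obtain ⟨x, hx⟩ := Finset.nonempty_iff_ne_empty.2 hne
      rw [restrictSign_of_not, mul_zero]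
      refine hv.not_stabilizes hx (y := a) fun h => ?_
      simpa using Finset.mem_powerset.1 hS h
    · simp
  · obtain ⟨b, hb⟩ : ∃ b, ¬ v.SameCycle b a := by
      by_contra! h
      exact hv fun i j => (h i).trans (h j).symm
    set C : Finset α := Finset.univ.filter (fun x => v.SameCycle b x) with hCdef
    have hC : Stabilizes C v := fun x => by simp [C]
    have hbC : b ∈ C := by simp [C, Perm.SameCycle.refl]
    have hsign : (-1) ^ C.card * restrictSign C v = -1 := by
      have : Nonempty {x // x ∈ C} := ⟨⟨b, hbC⟩⟩
      have hfull : IsFullCycle (v.subtypePerm (p := (· ∈ C)) hC) := by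
        rintro ⟨i, hi⟩ ⟨j, hj⟩
        rw [Perm.sameCycle_subtypePerm]
        simp only [C, Finset.mem_filter, Finset.mem_univ, true_and] at hi hj
        exact hi.symm.trans hj
      rw [restrictSign_of_stabilizes hC, hfull.sign, Fintype.card_coe]
      obtain ⟨k, hk⟩ : ∃ k, C.card = k + 1 :=
        Nat.exists_eq_succ_of_ne_zero (Finset.card_pos.2 ⟨b, hbC⟩).ne'
      rw [hk, Nat.add_sub_cancel, pow_succ, mul_neg_one, neg_mul, ← mul_pow]
      simp
    have hunion : ∀ S : Finset α, Disjoint S C →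
        (-1) ^ (S ∪ C).card * restrictSign (S ∪ C) v = -((-1) ^ S.card * restrictSign S v) := by
      intro S hd
      by_cases hS : Stabilizes S v
      · rw [restrictSign_union hd hS hC, Finset.card_union_of_disjoint hd, pow_add]
        linear_combination ((-1) ^ S.card * restrictSign S v) * hsign
      · rw [restrictSign_of_not hS, restrictSign_of_not]
        · simp
        · intro h
          apply hS
          intro x
          have h1 := h x
          have h2 := hC x
          have h3 : ∀ z, z ∈ S → z ∉ C := fun z hz => Finset.disjoint_left.1 hd hz
          simp only [Finset.mem_union] at h1
          have := h3 x
          have := h3 (v x)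
          tauto
    have hcases : ∀ S : Finset α, Stabilizes S v → Disjoint S C ∨ C ⊆ S := by
      intro S hS
      by_cases h : Disjoint S C
      · exact Or.inl h
      · right
        obtain ⟨z, hzS, hzC⟩ := Finset.not_disjoint_iff.1 h
        intro y hy
        simp only [C, Finset.mem_filter, Finset.mem_univ, true_and] at hzC hy
        obtain ⟨k, rfl⟩ := hzC.symm.trans hy
        have : ∀ k : ℤ, (v ^ k) z ∈ S := by
          intro k
          induction k using Int.induction_on with
          | zero => simpa
          | succ i ih => rwa [add_comm, zpow_add, zpow_one, Perm.mul_apply, hS]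
          | pred i ih =>
            rwa [sub_eq_neg_add, zpow_add, zpow_neg_one, Perm.mul_apply, hS.inv]
        exact this k
    have haC : a ∉ C := by simpa [C] using hb
    have hmem : ∀ (S : Finset α) x, x ∈ symmDiff S C ↔ (x ∈ S ∧ x ∉ C ∨ x ∈ C ∧ x ∉ S) :=
      fun S x => Finset.mem_symmDiff
    have hstab : ∀ S : Finset α, Stabilizes S v → Stabilizes (symmDiff S C) v := fun S hS x => by
      rw [hmem, hmem, hS x, hC x]
    have hsum : ∀ S : Finset α, (-1) ^ S.card * restrictSign S v +
        (-1) ^ (symmDiff S C).card * restrictSign (symmDiff S C) v = 0 := by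
      intro S
      by_cases hS : Stabilizes S v
      · rcases hcases S hS with hd | hsub
        · have h1 : symmDiff S C = S ∪ C := by
            rw [hd.symmDiff_eq_sup, Finset.sup_eq_union]
          rw [h1, hunion S hd]
          ring
        · have h1 : S = symmDiff S C ∪ C := by
            ext x
            have := @hsub x
            rw [Finset.mem_union, hmem]
            tauto
          have h2 : Disjoint (symmDiff S C) C := Finset.disjoint_left.2 fun x => by
            have := @hsub x
            rw [hmem]
            tauto
          have h3 := hunion _ h2
          rw [← h1] at h3
          linear_combination h3
      · rw [restrictSign_of_not hS, restrictSign_of_not, mul_zero, mul_zero, add_zero]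
        intro h
        apply hS
        simpa using hstab _ h
    refine Finset.sum_involution (fun S _ => symmDiff S C) (fun S _ => hsum S) ?_ ?_ ?_
    · intro S _ _ h
      have := hmem S b
      rw [h] at this
      tauto
    · intro S hS
      rw [Finset.mem_powerset] at hS ⊢
      intro x hx
      rw [hmem] at hx
      rw [Finset.mem_erase]
      refine ⟨?_, Finset.mem_univ _⟩
      rintro rfl
      have := @hS x
      simp at this
      tauto
    · intro S _
      simp

theorem sameCycle_swap_mul_self {v : Perm α} {x y : α} (hxy : ¬ v.SameCycle x y) :
    (swap x y * v).SameCycle x y := by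
  by_contra hw
  set w := swap x y * v with hwdef
  set A : Finset α := Finset.univ.filter fun i => w.SameCycle x i ∧ v.SameCycle x i with hA
  have hxA : x ∈ A := by simp [A, Perm.SameCycle.refl]
  have hmem : ∀ i, i ∈ A → v i ∈ A.erase x := by
    intro i hi
    simp only [A, Finset.mem_filter, Finset.mem_univ, true_and, Finset.mem_erase] at hi ⊢
    have h1 : v.SameCycle x (v i) := hi.2.apply_right
    have h2 : w.SameCycle x (w i) := hi.1.apply_right
    have h3 : v i ≠ y := by
      intro h
      exact hxy (h ▸ h1)
    have h4 : v i ≠ x := by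
      intro h
      have : w i = y := by simp [hwdef, h]
      exact hw (this ▸ h2)
    have h5 : w i = v i := by
      rw [hwdef, Perm.mul_apply, swap_apply_of_ne_of_ne h4 h3]
    exact ⟨h4, h5 ▸ h2, h1⟩
  have := Finset.card_le_card_of_injOn v hmem v.injective.injOn
  rw [Finset.card_erase_of_mem hxA] at this
  have := Finset.card_pos.2 ⟨x, hxA⟩
  omega

theorem sameCycle_swap_mul_iff {v : Perm α} {x y : α} (hxy : ¬ v.SameCycle x y) (i j : α) :
    (swap x y * v).SameCycle i j ↔ v.SameCycle i j ∨
      (v.SameCycle i x ∧ v.SameCycle y j) ∨ (v.SameCycle i y ∧ v.SameCycle x j) := by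
  have hE := equivalence_sameCycle v
  have hF := equivalence_sameCycle (swap x y * v)
  have hself := sameCycle_swap_mul_self hxy
  have hle : ∀ {i j}, v.SameCycle i j → (swap x y * v).SameCycle i j := by
    intro i j hij
    refine Perm.SameCycle.of_apply hF (fun z => ?_) hij
    have hz : (swap x y * v).SameCycle z (swap x y (v z)) :=
      (Perm.SameCycle.refl (swap x y * v) z).apply_right
    by_cases h1 : v z = x
    · rw [h1, swap_apply_left] at hz
      rw [h1]
      exact hz.trans hself.symm
    · by_cases h2 : v z = y
      · rw [h2, swap_apply_right] at hz
        rw [h2]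
        exact hz.trans hself
      · rwa [swap_apply_of_ne_of_ne h1 h2] at hz
  constructor
  · refine Perm.SameCycle.of_apply (r := fun i j => v.SameCycle i j ∨
      (v.SameCycle i x ∧ v.SameCycle y j) ∨ (v.SameCycle i y ∧ v.SameCycle x j)) ?_ ?_
    · refine ⟨fun i => Or.inl (hE.refl i), ?_, ?_⟩
      · rintro i j (h | ⟨h1, h2⟩ | ⟨h1, h2⟩)
        · exact Or.inl h.symm
        · exact Or.inr (Or.inr ⟨h2.symm, h1.symm⟩)
        · exact Or.inr (Or.inl ⟨h2.symm, h1.symm⟩)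
      · rintro i j k (h | ⟨h1, h2⟩ | ⟨h1, h2⟩) (h' | ⟨h1', h2'⟩ | ⟨h1', h2'⟩)
        · exact Or.inl (h.trans h')
        · exact Or.inr (Or.inl ⟨h.trans h1', h2'⟩)
        · exact Or.inr (Or.inr ⟨h.trans h1', h2'⟩)
        · exact Or.inr (Or.inl ⟨h1, h2.trans h'⟩)
        · exact absurd (h2.trans h1').symm hxy
        · exact Or.inl (h1.trans h2')
        · exact Or.inr (Or.inr ⟨h1, h2.trans h'⟩)
        · exact Or.inl (h1.trans h2')
        · exact absurd (h2.trans h1') hxy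
    · intro z
      have hz : v.SameCycle z (v z) := (Perm.SameCycle.refl v z).apply_right
      rw [Perm.mul_apply]
      by_cases h1 : v z = x
      · rw [h1] at hz ⊢
        rw [swap_apply_left]
        exact Or.inr (Or.inl ⟨hz, hE.refl y⟩)
      · by_cases h2 : v z = y
        · rw [h2] at hz ⊢
          rw [swap_apply_right]
          exact Or.inr (Or.inr ⟨hz, hE.refl x⟩)
        · rw [swap_apply_of_ne_of_ne h1 h2]
          exact Or.inl hz
  · rintro (h | ⟨h1, h2⟩ | ⟨h1, h2⟩)
    · exact hle h
    · exact (hle h1).trans (hself.trans (hle h2))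
    · exact (hle h1).trans (hself.symm.trans (hle h2))

theorem sum_restrictSign_mul (S : Finset α) (F : Perm α → ℚ) :
    ∑ w, restrictSign S w * F w =
      ∑ p : Perm {x // x ∈ S}, ∑ q : Perm {x // x ∉ S},
        ((Perm.sign p : ℤ) : ℚ) * F (Perm.subtypeCongr p q) := by
  rw [← Fintype.sum_prod_type']
  symm
  refine Finset.sum_of_injOn (fun pq => Perm.subtypeCongr pq.1 pq.2) ?_ ?_ ?_ ?_
  · exact (Perm.subtypeCongrHom_injective (· ∈ S)).injOn
  · intro _ _
    simp
  · intro w _ hw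
    rw [restrictSign_of_not, zero_mul]
    intro h
    obtain ⟨p, q, rfl⟩ := stabilizes_iff_exists.1 h
    exact hw ⟨(p, q), by simp, rfl⟩
  · rintro ⟨p, q⟩ _
    simp only [restrictSign_subtypeCongr]

theorem isFullCycle_swap_mul_subtypeCongr {S : Finset α} (p : Perm {x // x ∈ S})
    (q : Perm {x // x ∉ S}) {x y : α} (hx : x ∈ S) (hy : y ∉ S) :
    IsFullCycle (swap x y * Perm.subtypeCongr p q) ↔ IsFullCycle p ∧ IsFullCycle q := by
  have hs := stabilizes_subtypeCongr p q
  have hxy : ¬ (Perm.subtypeCongr p q).SameCycle x y := fun h => hy ((hs.mem_iff h).1 hx)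
  constructor
  · intro h
    constructor
    · rintro ⟨i, hi⟩ ⟨j, hj⟩
      rw [← sameCycle_subtypeCongr_left p q]
      rcases (sameCycle_swap_mul_iff hxy i j).1 (h i j) with h | ⟨_, h⟩ | ⟨h, _⟩
      · exact h
      · exact absurd ((hs.mem_iff h).2 hj) hy
      · exact absurd ((hs.mem_iff h).1 hi) hy
    · rintro ⟨i, hi⟩ ⟨j, hj⟩
      rw [← sameCycle_subtypeCongr_right p q]
      rcases (sameCycle_swap_mul_iff hxy i j).1 (h i j) with h | ⟨h, _⟩ | ⟨_, h⟩
      · exact h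
      · exact absurd ((hs.mem_iff h).2 hx) hi
      · exact absurd ((hs.mem_iff h).1 hx) hj
  · rintro ⟨hp, hq⟩ i j
    rw [sameCycle_swap_mul_iff hxy]
    by_cases hi : i ∈ S <;> by_cases hj : j ∈ S
    · exact Or.inl ((sameCycle_subtypeCongr_left p q hi hj).2 (hp _ _))
    · exact Or.inr (Or.inl ⟨(sameCycle_subtypeCongr_left p q hi hx).2 (hp _ _),
        (sameCycle_subtypeCongr_right p q hy hj).2 (hq _ _)⟩)
    · exact Or.inr (Or.inr ⟨(sameCycle_subtypeCongr_right p q hi hy).2 (hq _ _),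
        (sameCycle_subtypeCongr_left p q hx hj).2 (hp _ _)⟩)
    · exact Or.inl ((sameCycle_subtypeCongr_right p q hi hj).2 (hq _ _))

theorem sum_sign_of_card_le_one [DecidableEq α] (h : Fintype.card α ≤ 1) :
    ∑ p : Perm α, ((Perm.sign p : ℤ) : ℚ) = 1 := by
  have := Fintype.card_le_one_iff_subsingleton.1 h
  rw [Fintype.sum_subsingleton _ (1 : Perm α)]
  simp

theorem sum_sign_of_one_lt_card [DecidableEq α] (h : 1 < Fintype.card α) :
    ∑ p : Perm α, ((Perm.sign p : ℤ) : ℚ) = 0 := by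
  obtain ⟨x, y, hxy⟩ := Fintype.one_lt_card_iff.1 h
  have := Equiv.sum_comp (Equiv.mulLeft (swap x y)) fun p : Perm α => ((Perm.sign p : ℤ) : ℚ)
  simp only [Equiv.coe_mulLeft, Perm.sign_mul, Perm.sign_swap hxy, neg_mul, one_mul,
    Units.val_neg, Int.cast_neg, Finset.sum_neg_distrib] at this
  linarith

theorem card_compl_subtype (S : Finset α) :
    Fintype.card {x // x ∉ S} = Fintype.card α - S.card := by
  rw [Fintype.card_subtype_compl, Fintype.card_coe]

theorem sum_restrictSign (S : Finset α) :
    ∑ v, restrictSign S v =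
      if S.card ≤ 1 then ((Fintype.card α - S.card).factorial : ℚ) else 0 := by
  have h := sum_restrictSign_mul S (fun _ => 1)
  simp only [mul_one, Finset.sum_const, Finset.card_univ, nsmul_eq_mul, Fintype.card_perm,
    card_compl_subtype, ← Finset.mul_sum] at h
  rw [h]
  split_ifs with hS
  · rw [sum_sign_of_card_le_one (by rwa [Fintype.card_coe]), mul_one]
  · rw [sum_sign_of_one_lt_card (by rw [Fintype.card_coe]; omega), mul_zero]

theorem sum_isFullCycle [hdec : DecidableEq α] [Nonempty α] :
    ∑ v : Perm α, (if IsFullCycle v then (1 : ℚ) else 0) =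
      ((Fintype.card α - 1).factorial : ℚ) := by
  obtain rfl : hdec = fun a b => Classical.propDecidable (a = b) := Subsingleton.elim _ _
  obtain ⟨a⟩ := ‹Nonempty α›
  simp_rw [← sum_restrictSign_powerset a]
  rw [Finset.sum_comm]
  simp_rw [← Finset.mul_sum, sum_restrictSign]
  rw [sum_powerset_of_card_le_one]
  · obtain ⟨k, hk⟩ : ∃ k, Fintype.card α = k + 1 :=
      Nat.exists_eq_succ_of_ne_zero (Fintype.card_pos_iff.2 ⟨a⟩).ne'
    simp [hk, Nat.factorial_succ]
    ring
  · intro S _ hS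
    rw [if_neg (by omega), mul_zero]

theorem sum_sign_mul_isFullCycle [DecidableEq α] [Nonempty α] :
    ∑ v : Perm α, ((Perm.sign v : ℤ) : ℚ) * (if IsFullCycle v then 1 else 0) =
      (-1) ^ (Fintype.card α - 1) * ((Fintype.card α - 1).factorial : ℚ) := by
  rw [← sum_isFullCycle, Finset.mul_sum]
  refine Finset.sum_congr rfl fun v _ => ?_
  split_ifs with h
  · rw [h.sign]
  · simp

theorem not_sameCycle_swap_mul {v : Perm α} {x y : α} (hne : x ≠ y) (hxy : v.SameCycle x y) :
    ¬ (swap x y * v).SameCycle x y := by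
  have hex : ∃ k : ℕ, (v ^ k) x = y := hxy.exists_nat_pow_eq
  set k := Nat.find hex with hk
  have hky : (v ^ k) x = y := Nat.find_spec hex
  have hmin : ∀ t < k, (v ^ t) x ≠ y := fun t ht => Nat.find_min hex ht
  have hk0 : 0 < k := by
    rcases Nat.eq_zero_or_pos k with h | h
    · rw [h] at hky
      exact absurd hky hne
    · exact h
  set A : Finset α := (Finset.range k).image fun t => (v ^ t) x with hA
  have hxA : x ∈ A := Finset.mem_image.2 ⟨0, by simpa using hk0, by simp⟩
  have hyA : y ∉ A := by
    intro h
    obtain ⟨t, ht, hty⟩ := Finset.mem_image.1 h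
    exact hmin t (Finset.mem_range.1 ht) hty
  have hstab : Stabilizes A (swap x y * v) := by
    refine stabilizes_of_mapsTo fun z hz => ?_
    obtain ⟨t, ht, rfl⟩ := Finset.mem_image.1 hz
    rw [Finset.mem_range] at ht
    rw [Perm.mul_apply, show v ((v ^ t) x) = (v ^ (t + 1)) x by rw [pow_succ', Perm.mul_apply]]
    by_cases h : t + 1 = k
    · rw [h, hky, swap_apply_right]
      exact hxA
    · by_cases h' : (v ^ (t + 1)) x = x
      · exfalso
        have hlt : k - (t + 1) < k := by omega
        apply hmin _ hlt
        conv_lhs => rw [← h', ← Perm.mul_apply, ← pow_add]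
        rw [Nat.sub_add_cancel (by omega), hky]
      · rw [swap_apply_of_ne_of_ne h' (hmin _ (by omega))]
        exact Finset.mem_image.2 ⟨t + 1, by simp; omega, rfl⟩
  exact fun h => hyA ((hstab.mem_iff h).1 hxA)

theorem two_mul_sum_sameCycle [hdec : DecidableEq α] {x y : α} (hxy : x ≠ y) :
    2 * ∑ v : Perm α, (if v.SameCycle x y then (1 : ℚ) else 0) =
      ((Fintype.card α).factorial : ℚ) := by
  obtain rfl : hdec = fun a b => Classical.propDecidable (a = b) := Subsingleton.elim _ _
  have h := Equiv.sum_comp (Equiv.mulLeft (swap x y))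
    fun v : Perm α => if v.SameCycle x y then (1 : ℚ) else 0
  rw [two_mul]
  nth_rewrite 1 [← h]
  rw [← Finset.sum_add_distrib, ← Fintype.card_perm, ← Finset.card_univ, Finset.cast_card]
  refine Finset.sum_congr rfl fun v _ => ?_
  rw [Equiv.coe_mulLeft]
  by_cases hv : v.SameCycle x y
  · rw [if_neg (not_sameCycle_swap_mul hxy hv), if_pos hv, zero_add]
  · rw [if_pos (sameCycle_swap_mul_self hv), if_neg hv, add_zero]

theorem sign_subtypeCongr_cast {S : Finset α} (p : Perm {x // x ∈ S}) (q : Perm {x // x ∉ S}) :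
    ((Perm.sign (Perm.subtypeCongr p q) : ℤ) : ℚ) =
      ((Perm.sign p : ℤ) : ℚ) * ((Perm.sign q : ℤ) : ℚ) := by
  rw [← Int.cast_mul, ← Units.val_mul]
  congr 2
  convert Perm.sign_subtypeCongr (p := (· ∈ S)) p q

theorem sign_cast_mul_self [DecidableEq α] (p : Perm α) :
    ((Perm.sign p : ℤ) : ℚ) * ((Perm.sign p : ℤ) : ℚ) = 1 := by
  rw [← Int.cast_mul, ← Units.val_mul, Int.units_mul_self]
  simp

/-- The signed count of permutations, weighted by the length of the cycle of `i`. -/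
theorem sum_sign_mul_sameCycle [hdec : DecidableEq α] (i : α) :
    ∑ j, ∑ p : Perm α, ((Perm.sign p : ℤ) : ℚ) * (if p.SameCycle i j then 1 else 0) =
      (-1) ^ (Fintype.card α - 1) * ((Fintype.card α - 1).factorial : ℚ) := by
  obtain rfl : hdec = fun a b => Classical.propDecidable (a = b) := Subsingleton.elim _ _
  have hpoint : ∀ p : Perm α,
      ∑ j, ((Perm.sign p : ℤ) : ℚ) * (if p.SameCycle i j then 1 else 0) =
      ∑ D ∈ (Finset.univ.erase i).powerset, restrictSign D p * (restrictSign D p *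
        (((Perm.sign p : ℤ) : ℚ) *
          if ∀ k l, k ∉ D → l ∉ D → p.SameCycle k l then ((Fintype.card α - D.card : ℕ) : ℚ)
            else 0)) := by
    intro p
    set D : Finset α := Finset.univ.filter fun j => ¬ p.SameCycle i j with hD
    have hmemD : ∀ j, j ∈ D ↔ ¬ p.SameCycle i j := fun j => by simp [D]
    have hDstab : Stabilizes D p := fun j => by simp [D]
    rw [Finset.sum_eq_single D]
    · rw [← mul_assoc, restrictSign_mul_self hDstab, one_mul, if_pos, ← Finset.mul_sum]
      · congr 1
        rw [Finset.sum_boole, ← Finset.card_compl]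
        congr 2
        ext j
        simp [D]
      · intro k l hk hl
        rw [hmemD, not_not] at hk hl
        exact hk.symm.trans hl
    · intro E hE hne
      by_cases hs : Stabilizes E p
      · have hiE : i ∉ E := fun h => by simpa using Finset.mem_powerset.1 hE h
        rw [if_neg, mul_zero, mul_zero, mul_zero]
        intro h
        apply hne
        ext j
        rw [hmemD]
        refine ⟨fun hj hij => hiE ((hs.mem_iff hij).2 hj), fun hj => ?_⟩
        by_contra hjE
        exact hj (h i j hiE hjE)
      · rw [restrictSign_of_not hs, zero_mul]
    · intro h
      exact absurd (Finset.mem_powerset.2 fun j hj => by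
        rw [hmemD] at hj
        rw [Finset.mem_erase]
        refine ⟨?_, Finset.mem_univ _⟩
        rintro rfl
        exact hj (Perm.SameCycle.refl p _)) h
  have hset : ∀ D ∈ (Finset.univ.erase i).powerset, ∑ p : Perm α, restrictSign D p *
      (restrictSign D p * (((Perm.sign p : ℤ) : ℚ) *
          if ∀ k l, k ∉ D → l ∉ D → p.SameCycle k l then ((Fintype.card α - D.card : ℕ) : ℚ)
            else 0)) =
      (if D.card ≤ 1 then 1 else 0) * ((-1) ^ (Fintype.card α - D.card - 1) *
        ((Fintype.card α - D.card).factorial : ℚ)) := by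
    intro D hD
    have hiD : i ∉ D := fun h => by simpa using Finset.mem_powerset.1 hD h
    have : Nonempty {x // x ∉ D} := ⟨⟨i, hiD⟩⟩
    have hpos : 0 < Fintype.card α - D.card := by
      rw [← card_compl_subtype]; exact Fintype.card_pos
    have hfull : ∀ (p : Perm {x // x ∈ D}) (q : Perm {x // x ∉ D}),
        (∀ k l, k ∉ D → l ∉ D → (Perm.subtypeCongr p q).SameCycle k l) ↔ IsFullCycle q := by
      intro p q
      constructor
      · rintro h ⟨k, hk⟩ ⟨l, hl⟩
        exact (sameCycle_subtypeCongr_right p q hk hl).1 (h k l hk hl)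
      · intro h k l hk hl
        exact (sameCycle_subtypeCongr_right p q hk hl).2 (h _ _)
    rw [sum_restrictSign_mul]
    have hterm : ∀ (p : Perm {x // x ∈ D}) (q : Perm {x // x ∉ D}),
        ((Perm.sign p : ℤ) : ℚ) * (restrictSign D (Perm.subtypeCongr p q) *
          (((Perm.sign (Perm.subtypeCongr p q) : ℤ) : ℚ) *
          if ∀ k l, k ∉ D → l ∉ D → (Perm.subtypeCongr p q).SameCycle k l then
            ((Fintype.card α - D.card : ℕ) : ℚ) else 0)) =
        ((Perm.sign p : ℤ) : ℚ) * (((Fintype.card α - D.card : ℕ) : ℚ) *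
          (((Perm.sign q : ℤ) : ℚ) * if IsFullCycle q then 1 else 0)) := by
      intro p q
      rw [restrictSign_subtypeCongr, sign_subtypeCongr_cast, if_congr (hfull p q) rfl rfl]
      have := sign_cast_mul_self p
      split_ifs
      · linear_combination (((Perm.sign p : ℤ) : ℚ) * ((Perm.sign q : ℤ) : ℚ) *
          ((Fintype.card α - D.card : ℕ) : ℚ)) * this
      · simp
    simp_rw [hterm, ← Finset.mul_sum]
    rw [← Finset.sum_mul, sum_sign_mul_isFullCycle, card_compl_subtype]
    obtain ⟨k, hk⟩ := Nat.exists_eq_succ_of_ne_zero hpos.ne'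
    rw [hk]
    split_ifs with hc
    · rw [sum_sign_of_card_le_one (by rwa [Fintype.card_coe]), Nat.succ_sub_one,
        Nat.factorial_succ]
      push_cast
      ring
    · rw [sum_sign_of_one_lt_card (by rw [Fintype.card_coe]; omega), zero_mul, zero_mul]
  rw [Finset.sum_comm]
  simp_rw [hpoint]
  rw [Finset.sum_comm, Finset.sum_congr rfl hset, sum_powerset_of_card_le_one]
  · obtain ⟨k, hk⟩ : ∃ k, Fintype.card α = k + 1 :=
      Nat.exists_eq_succ_of_ne_zero (Fintype.card_pos_iff.2 ⟨i⟩).ne'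
    simp only [Finset.card_empty, Finset.card_singleton, Finset.sum_const,
      Finset.card_erase_of_mem (Finset.mem_univ _), Finset.card_univ, hk, zero_le_one,
      if_true, le_refl, Nat.sub_zero, Nat.add_sub_cancel, nsmul_eq_mul, one_mul]
    rcases k with _ | k
    · simp
    · rw [Nat.add_sub_cancel, Nat.factorial_succ (k + 1), pow_succ]
      push_cast
      ring
  · intro D _ hD
    rw [if_neg (by omega), zero_mul]

theorem restrictSign_conj_swap {S : Finset α} {u w : Perm α} {z₁ z₂ : α} (h₁ : z₁ ∈ S)
    (h₂ : z₂ ∈ S) (hz : z₁ ≠ z₂) (hw₁ : w z₁ ∉ S) (hw₂ : w z₂ ∉ S)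
    (h : Stabilizes S (u⁻¹ * w)) :
    restrictSign S ((swap (w z₁) (w z₂) * u * (swap (w z₁) (w z₂))⁻¹)⁻¹ * w) =
      -restrictSign S (u⁻¹ * w) := by
  have hu₁ : u⁻¹ (w z₁) ∈ S := (h z₁).2 h₁
  have hu₂ : u⁻¹ (w z₂) ∈ S := (h z₂).2 h₂
  have hne : u⁻¹ (w z₁) ≠ u⁻¹ (w z₂) := fun h => hz (w.injective (u⁻¹.injective h))
  have heq : (swap (w z₁) (w z₂) * u * (swap (w z₁) (w z₂))⁻¹)⁻¹ * w =
      swap (w z₁) (w z₂) * (swap (u⁻¹ (w z₁)) (u⁻¹ (w z₂)) * (u⁻¹ * w)) := by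
    have : swap (u⁻¹ (w z₁)) (u⁻¹ (w z₂)) = u⁻¹ * swap (w z₁) (w z₂) * u := by
      rw [swap_apply_apply, inv_inv]
    rw [this]
    simp [mul_assoc]
  rw [heq, restrictSign_mul (stabilizes_swap_notMem hw₁ hw₂),
    restrictSign_mul (stabilizes_swap_mem hu₁ hu₂), restrictSign_swap_notMem hw₁ hw₂,
    restrictSign_swap_mem hu₁ hu₂ hne]
  ring

theorem sum_isFullCycle_eq_zero {S : Finset α} {w : Perm α} {z₁ z₂ : α} (h₁ : z₁ ∈ S)
    (h₂ : z₂ ∈ S) (hz : z₁ ≠ z₂) (hw₁ : w z₁ ∉ S) (hw₂ : w z₂ ∉ S) :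
    ∑ u : Perm α, (if IsFullCycle u then 1 else 0) * restrictSign S (u⁻¹ * w) = 0 := by
  set t := swap (w z₁) (w z₂) with ht
  have hneg : ∀ u : Perm α, restrictSign S ((t * u * t⁻¹)⁻¹ * w) =
      -restrictSign S (u⁻¹ * w) := by
    intro u
    by_cases hs : Stabilizes S (u⁻¹ * w)
    · exact restrictSign_conj_swap h₁ h₂ hz hw₁ hw₂ hs
    · by_cases hs' : Stabilizes S ((t * u * t⁻¹)⁻¹ * w)
      · have := restrictSign_conj_swap h₁ h₂ hz hw₁ hw₂ hs'
        rw [← ht] at this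
        have heq : t * (t * u * t⁻¹) * t⁻¹ = u := by
          rw [ht, swap_inv]
          simp [mul_assoc]
        rw [heq] at this
        linarith
      · rw [restrictSign_of_not hs, restrictSign_of_not hs', neg_zero]
  have := Equiv.sum_comp (MulAut.conj t).toEquiv
    fun u : Perm α => (if IsFullCycle u then (1 : ℚ) else 0) * restrictSign S (u⁻¹ * w)
  simp only [MulEquiv.toEquiv_eq_coe, EquivLike.coe_coe, MulAut.conj_apply, hneg,
    isFullCycle_conj_iff, mul_neg, Finset.sum_neg_distrib] at this
  linarith

theorem sum_isFullCycle_swap_mul {S : Finset α} {w : Perm α} {x y : α} (hx : x ∈ S) (hy : y ∉ S)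
    (hw : Stabilizes S (swap x y * w)) :
    ∑ u : Perm α, (if IsFullCycle u then 1 else 0) * restrictSign S (u⁻¹ * w) =
      (-1) ^ (S.card - 1) * ((S.card - 1).factorial : ℚ) *
        ((Fintype.card α - S.card - 1).factorial : ℚ) * restrictSign S (swap x y * w) := by
  have : Nonempty {x // x ∈ S} := ⟨⟨x, hx⟩⟩
  have : Nonempty {x // x ∉ S} := ⟨⟨y, hy⟩⟩
  rw [← Equiv.sum_comp (Equiv.mulLeft (swap x y))]
  have hterm : ∀ u : Perm α, (if IsFullCycle (Equiv.mulLeft (swap x y) u) then (1 : ℚ) else 0) *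
      restrictSign S ((Equiv.mulLeft (swap x y) u)⁻¹ * w) =
      restrictSign S (swap x y * w) *
        (restrictSign S u * if IsFullCycle (swap x y * u) then 1 else 0) := by
    intro u
    rw [Equiv.coe_mulLeft, mul_inv_rev, swap_inv, mul_assoc u⁻¹]
    by_cases hu : Stabilizes S u
    · rw [restrictSign_mul hu.inv, restrictSign_inv hu]
      ring
    · rw [restrictSign_of_not hu, restrictSign_of_not]
      · simp
      · intro h
        apply hu
        simpa [mul_assoc] using (h.mul hw.inv).inv
  simp_rw [hterm]
  rw [← Finset.mul_sum, sum_restrictSign_mul]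
  have hfull : ∀ (p : Perm {x // x ∈ S}) (q : Perm {x // x ∉ S}),
      ((Perm.sign p : ℤ) : ℚ) *
        (if IsFullCycle (swap x y * Perm.subtypeCongr p q) then 1 else 0) =
      (((Perm.sign p : ℤ) : ℚ) * if IsFullCycle p then 1 else 0) *
        if IsFullCycle q then 1 else 0 := by
    intro p q
    rw [if_congr (isFullCycle_swap_mul_subtypeCongr p q hx hy) rfl rfl]
    split_ifs <;> simp_all
  simp_rw [hfull, ← Finset.mul_sum, ← Finset.sum_mul]
  rw [sum_isFullCycle, sum_sign_mul_isFullCycle, card_compl_subtype, Fintype.card_coe]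
  ring

theorem sum_isFullCycle_mul_restrictSign {S : Finset α} {x₁ y₁ : α} (hx₁ : x₁ ∈ S) (hy₁ : y₁ ∉ S)
    (w : Perm α) :
    ∑ u : Perm α, (if IsFullCycle u then 1 else 0) * restrictSign S (u⁻¹ * w) =
      (-1) ^ (S.card - 1) * ((S.card - 1).factorial : ℚ) *
        ((Fintype.card α - S.card - 1).factorial : ℚ) *
          ∑ x ∈ S, ∑ y ∈ Sᶜ, restrictSign S (swap x y * w) := by
  by_cases hw : Stabilizes S w
  · rw [Finset.sum_eq_zero, Finset.sum_eq_zero, mul_zero]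
    · intro x hx
      refine Finset.sum_eq_zero fun y hy => restrictSign_of_not fun h => ?_
      apply not_stabilizes_swap hx (Finset.mem_compl.1 hy)
      simpa using h.mul hw.inv
    · intro u _
      split_ifs with hu
      · rw [restrictSign_of_not, mul_zero]
        intro h
        apply hu.not_stabilizes hx₁ hy₁
        simpa using (h.mul hw.inv).inv
      · rw [zero_mul]
  · obtain ⟨z₀, hz₀, hwz₀⟩ : ∃ z ∈ S, w z ∉ S := by
      by_contra! h
      exact hw (stabilizes_of_mapsTo h)
    by_cases hex : ∃ z ∈ S, z ≠ z₀ ∧ w z ∉ S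
    · obtain ⟨z, hz, hne, hwz⟩ := hex
      rw [sum_isFullCycle_eq_zero hz hz₀ hne hwz hwz₀, Finset.sum_eq_zero, mul_zero]
      intro x hx
      refine Finset.sum_eq_zero fun y hy => restrictSign_of_not fun h => hne ?_
      exact w.injective ((h.eq_of_swap_mul hx hz hwz).trans (h.eq_of_swap_mul hx hz₀ hwz₀).symm)
    · push Not at hex
      obtain ⟨x₀, hx₀, hwx₀⟩ : ∃ x ∈ S, w⁻¹ x ∉ S := by
        by_contra! h
        exact hw (by simpa using (stabilizes_of_mapsTo h).inv)
      have hstab : Stabilizes S (swap x₀ (w z₀) * w) := by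
        refine stabilizes_of_mapsTo fun z hz => ?_
        rw [Perm.mul_apply]
        by_cases h : z = z₀
        · rw [h, swap_apply_right]
          exact hx₀
        · have h1 : w z ≠ x₀ := by
            rintro rfl
            simp [hz] at hwx₀
          rw [swap_apply_of_ne_of_ne h1 (w.injective.ne h)]
          exact hex z hz h
      rw [sum_isFullCycle_swap_mul hx₀ hwz₀ hstab, Finset.sum_eq_single_of_mem x₀ hx₀,
        Finset.sum_eq_single_of_mem (w z₀) (Finset.mem_compl.2 hwz₀)]
      · intro y hy hne
        exact restrictSign_of_not fun h => hne (h.eq_of_swap_mul hx₀ hz₀ hwz₀).symm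
      · intro x hx hne
        refine Finset.sum_eq_zero fun y hy => restrictSign_of_not fun h => ?_
        obtain rfl := h.eq_of_swap_mul hx hz₀ hwz₀
        have h1 := (h.mul hstab.inv x).2 hx
        have h2 : x ≠ w z₀ := fun h => hwz₀ (h ▸ hx)
        have h3 : (swap x (w z₀) * w * (swap x₀ (w z₀) * w)⁻¹) x = w z₀ := by
          rw [mul_inv_rev, swap_inv]
          simp [swap_apply_of_ne_of_ne hne h2]
        rw [h3] at h1
        exact hwz₀ h1

theorem two_mul_sum_sum_sameCycle [DecidableEq α] (i : α) :
    2 * ∑ j, ∑ p : Perm α, (if p.SameCycle i j then (1 : ℚ) else 0) =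
      ((Fintype.card α).factorial : ℚ) * ((Fintype.card α : ℚ) + 1) := by
  have hpos : 0 < Fintype.card α := Fintype.card_pos_iff.2 ⟨i⟩
  rw [← Finset.add_sum_erase _ _ (Finset.mem_univ i), mul_add,
    Finset.mul_sum (Finset.univ.erase i),
    Finset.sum_congr rfl fun j hj => two_mul_sum_sameCycle (Finset.ne_of_mem_erase hj).symm]
  simp only [Perm.SameCycle.refl, if_true, Finset.sum_const, Finset.card_univ,
    Fintype.card_perm, Finset.card_erase_of_mem (Finset.mem_univ _), nsmul_eq_mul, mul_one]
  rw [Nat.cast_sub hpos]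
  push_cast
  ring

theorem sum_sameCycle_mul_restrictSign {S : Finset α} {a b : α} (ha : a ∉ S) (hS : S.Nonempty) :
    ∑ w : Perm α, (if w.SameCycle a b then 1 else 0) *
      ∑ u : Perm α, (if IsFullCycle u then 1 else 0) * restrictSign S (u⁻¹ * w) =
    (-1) ^ (S.card - 1) * ((S.card - 1).factorial : ℚ) *
      ((Fintype.card α - S.card - 1).factorial : ℚ) *
        ∑ x : {x // x ∈ S}, ∑ y : {y // y ∉ S}, ∑ p : Perm {x // x ∈ S}, ∑ q : Perm {x // x ∉ S},
          ((Perm.sign p : ℤ) : ℚ) *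
            if (swap (x : α) y * Perm.subtypeCongr p q).SameCycle a b then 1 else 0 := by
  obtain ⟨x₁, hx₁⟩ := hS
  have hinner : ∀ x y : α,
      ∑ w : Perm α, (if w.SameCycle a b then 1 else 0) * restrictSign S (swap x y * w) =
      ∑ p : Perm {x // x ∈ S}, ∑ q : Perm {x // x ∉ S}, ((Perm.sign p : ℤ) : ℚ) *
        if (swap x y * Perm.subtypeCongr p q).SameCycle a b then 1 else 0 := by
    intro x y
    rw [← sum_restrictSign_mul S fun w => if (swap x y * w).SameCycle a b then 1 else 0,
      ← Equiv.sum_comp (Equiv.mulLeft (swap x y))]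
    refine Finset.sum_congr rfl fun w _ => ?_
    rw [Equiv.coe_mulLeft, swap_mul_self_mul, mul_comm]
  simp_rw [sum_isFullCycle_mul_restrictSign hx₁ ha, ← hinner]
  rw [Finset.sum_coe_sort S fun x => ∑ y : {y // y ∉ S}, ∑ w : Perm α,
    (if w.SameCycle a b then 1 else 0) * restrictSign S (swap x (y : α) * w)]
  have hy : ∀ x, ∑ y : {y // y ∉ S}, ∑ w : Perm α,
      (if w.SameCycle a b then 1 else 0) * restrictSign S (swap x (y : α) * w) =
      ∑ y ∈ Sᶜ, ∑ w : Perm α, (if w.SameCycle a b then 1 else 0) *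
        restrictSign S (swap x y * w) := fun x =>
    (Finset.sum_subtype Sᶜ (fun _ => Finset.mem_compl) fun y => ∑ w : Perm α,
      (if w.SameCycle a b then 1 else 0) * restrictSign S (swap x y * w)).symm
  simp_rw [hy, Finset.mul_sum]
  rw [Finset.sum_comm]
  refine Finset.sum_congr rfl fun x _ => ?_
  rw [Finset.sum_comm]
  refine Finset.sum_congr rfl fun y _ => Finset.sum_congr rfl fun w _ => ?_
  ring

theorem sameCycle_swap_mul_subtypeCongr_notMem {S : Finset α} {a b : α} (ha : a ∉ S)
    (hb : b ∉ S) (x : {x // x ∈ S}) (y : {y // y ∉ S}) (p : Perm {x // x ∈ S})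
    (q : Perm {x // x ∉ S}) :
    (swap (x : α) y * Perm.subtypeCongr p q).SameCycle a b ↔ q.SameCycle ⟨a, ha⟩ ⟨b, hb⟩ := by
  have hs := stabilizes_subtypeCongr p q
  rw [sameCycle_swap_mul_iff fun h => y.2 ((hs.mem_iff h).1 x.2),
    sameCycle_subtypeCongr_right p q ha hb]
  refine ⟨?_, Or.inl⟩
  rintro (h | ⟨h, -⟩ | ⟨-, h⟩)
  · exact h
  · exact absurd ((hs.mem_iff h).2 x.2) ha
  · exact absurd ((hs.mem_iff h).1 x.2) hb

theorem sameCycle_swap_mul_subtypeCongr_mem {S : Finset α} {a b : α} (ha : a ∉ S)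
    (hb : b ∈ S) (x : {x // x ∈ S}) (y : {y // y ∉ S}) (p : Perm {x // x ∈ S})
    (q : Perm {x // x ∉ S}) :
    (swap (x : α) y * Perm.subtypeCongr p q).SameCycle a b ↔
      p.SameCycle ⟨b, hb⟩ x ∧ q.SameCycle ⟨a, ha⟩ y := by
  have hs := stabilizes_subtypeCongr p q
  rw [sameCycle_swap_mul_iff fun h => y.2 ((hs.mem_iff h).1 x.2),
    sameCycle_subtypeCongr_right p q ha y.2, sameCycle_subtypeCongr_left p q x.2 hb,
    Perm.sameCycle_comm (f := p)]
  constructor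
  · rintro (h | ⟨h, -⟩ | ⟨h₁, h₂⟩)
    · exact absurd ((hs.mem_iff h).2 hb) ha
    · exact absurd ((hs.mem_iff h).2 x.2) ha
    · exact ⟨h₂, h₁⟩
  · exact fun h => Or.inr (Or.inr ⟨h.2, h.1⟩)

theorem two_mul_sum_sameCycle_mul_restrictSign_notMem {S : Finset α} {a b : α} (hab : a ≠ b)
    (ha : a ∉ S) (hb : b ∉ S) (hS : S.Nonempty) :
    2 * ∑ w : Perm α, (if w.SameCycle a b then 1 else 0) *
      ∑ u : Perm α, (if IsFullCycle u then 1 else 0) * restrictSign S (u⁻¹ * w) =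
    if S.card ≤ 1 then ((Fintype.card α - 1).factorial : ℚ) ^ 2 else 0 := by
  rw [sum_sameCycle_mul_restrictSign ha hS]
  simp_rw [sameCycle_swap_mul_subtypeCongr_notMem ha hb, ← Finset.mul_sum, ← Finset.sum_mul]
  split_ifs with hc
  · have h1 : S.card = 1 := le_antisymm hc hS.card_pos
    have h2 := two_mul_sum_sameCycle (α := {x // x ∉ S}) (x := ⟨a, ha⟩) (y := ⟨b, hb⟩)
      (by simpa using hab)
    rw [sum_sign_of_card_le_one (by rwa [Fintype.card_coe])]
    simp only [Finset.sum_const, Finset.card_univ, card_compl_subtype, Fintype.card_coe, h1,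
      nsmul_eq_mul] at h2 ⊢
    obtain ⟨k, hk⟩ : ∃ k, Fintype.card α = k + 2 := Nat.exists_eq_add_of_le'
      (Fintype.one_lt_card_iff.2 ⟨a, b, hab⟩)
    simp only [hk, show k + 2 - 1 = k + 1 by omega, Nat.add_sub_cancel, Nat.factorial_succ] at h2 ⊢
    push_cast at h2 ⊢
    simp only [Nat.factorial_zero]
    linear_combination ((k : ℚ) + 1) * (k.factorial : ℚ) * h2
  · rw [sum_sign_of_one_lt_card (by rw [Fintype.card_coe]; omega)]
    simp

theorem two_mul_sum_sameCycle_mul_restrictSign_mem {S : Finset α} {a b : α}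
    (ha : a ∉ S) (hb : b ∈ S) :
    2 * ∑ w : Perm α, (if w.SameCycle a b then 1 else 0) *
      ∑ u : Perm α, (if IsFullCycle u then 1 else 0) * restrictSign S (u⁻¹ * w) =
    ((S.card - 1).factorial : ℚ) ^ 2 * ((Fintype.card α - S.card - 1).factorial : ℚ) *
      ((Fintype.card α - S.card + 1).factorial : ℚ) := by
  rw [sum_sameCycle_mul_restrictSign ha ⟨b, hb⟩]
  have hterm : ∀ (x : {x // x ∈ S}) (y : {y // y ∉ S}) (p : Perm {x // x ∈ S})
      (q : Perm {x // x ∉ S}), (((Perm.sign p : ℤ) : ℚ) *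
        if (swap (x : α) y * Perm.subtypeCongr p q).SameCycle a b then 1 else 0) =
      (((Perm.sign p : ℤ) : ℚ) * if p.SameCycle ⟨b, hb⟩ x then 1 else 0) *
        if q.SameCycle ⟨a, ha⟩ y then 1 else 0 := by
    intro x y p q
    rw [if_congr (sameCycle_swap_mul_subtypeCongr_mem ha hb x y p q) rfl rfl]
    split_ifs <;> simp_all
  simp_rw [hterm, ← Finset.mul_sum, ← Finset.sum_mul, ← Finset.mul_sum, ← Finset.sum_mul]
  rw [sum_sign_mul_sameCycle]
  have h2 := two_mul_sum_sum_sameCycle (⟨a, ha⟩ : {x // x ∉ S})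
  rw [card_compl_subtype] at h2
  rw [Fintype.card_coe, Nat.factorial_succ, Nat.cast_mul, Nat.cast_succ]
  have h3 : ((-1 : ℚ) ^ (S.card - 1)) * (-1) ^ (S.card - 1) = 1 := by
    rw [← mul_pow]; simp
  linear_combination ((S.card - 1).factorial : ℚ) ^ 2 *
    ((Fintype.card α - S.card - 1).factorial : ℚ) * (((-1 : ℚ) ^ (S.card - 1)) ^ 2 * h2 +
      ((Fintype.card α - S.card).factorial : ℚ) * (((Fintype.card α - S.card : ℕ) : ℚ) + 1) * h3)

theorem alternating_sum_factorial_mul_factorial (n m : ℕ) (hm : m ≤ n + 1) :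
    ((n : ℚ) + 2) * ∑ j ∈ Finset.range m, (-1) ^ j * ((j.factorial : ℚ) * (n - j).factorial) =
      (n + 1).factorial - (-1) ^ m * (m.factorial * (n + 1 - m).factorial) := by
  induction m with
  | zero => simp
  | succ m ih =>
    obtain ⟨l, rfl⟩ := Nat.exists_eq_add_of_le (Nat.le_of_succ_le_succ hm)
    rw [Finset.sum_range_succ, mul_add, ih (by omega), Nat.factorial_succ m,
      show m + l + 1 - m = l + 1 by omega, show m + l + 1 - (m + 1) = l by omega,
      Nat.add_sub_cancel_left, Nat.factorial_succ l]
    push_cast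
    ring

theorem two_mul_sum_sameCycle_isFullCycle {a b : α} (hab : a ≠ b) {k : ℕ}
    (hk : Fintype.card α = k + 2) :
    2 * ∑ w : Perm α, (if w.SameCycle a b then 1 else 0) *
      ∑ u : Perm α, (if IsFullCycle u then 1 else 0) *
        (if IsFullCycle (u⁻¹ * w) then 1 else 0) =
      ((k + 1).factorial : ℚ) * (k + 2).factorial - k * ((k + 1).factorial : ℚ) ^ 2 -
        k.factorial * ∑ j ∈ Finset.range (k + 1),
          (-1) ^ j * ((j.factorial : ℚ) * (k + 2 - j).factorial) := by
  have : Nonempty α := ⟨a⟩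
  set f : Finset α → ℚ := fun S => 2 * ∑ w : Perm α, (if w.SameCycle a b then 1 else 0) *
    ∑ u : Perm α, (if IsFullCycle u then 1 else 0) * restrictSign S (u⁻¹ * w)
  have hf : ∀ S, f S = 2 * ∑ w : Perm α, (if w.SameCycle a b then 1 else 0) *
    ∑ u : Perm α, (if IsFullCycle u then 1 else 0) * restrictSign S (u⁻¹ * w) := fun _ => rfl
  have hsum : 2 * ∑ w : Perm α, (if w.SameCycle a b then 1 else 0) *
      ∑ u : Perm α, (if IsFullCycle u then 1 else 0) *
        (if IsFullCycle (u⁻¹ * w) then 1 else 0) =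
      ∑ S ∈ (Finset.univ.erase a).powerset, (-1) ^ S.card * f S := by
    simp_rw [← sum_restrictSign_powerset a (_⁻¹ * _), hf, Finset.mul_sum]
    symm
    rw [Finset.sum_comm]
    refine Finset.sum_congr rfl fun w _ => ?_
    rw [Finset.sum_comm]
    refine Finset.sum_congr rfl fun u _ => Finset.sum_congr rfl fun S _ => ?_
    ring
  have hempty : f ∅ = ((k + 1).factorial : ℚ) * (k + 2).factorial := by
    simp_rw [hf, restrictSign_empty, mul_one]
    rw [sum_isFullCycle, ← Finset.sum_mul, ← mul_assoc, two_mul_sum_sameCycle hab, hk, mul_comm]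
    rfl
  have hb : b ∈ Finset.univ.erase a := Finset.mem_erase.2 ⟨hab.symm, Finset.mem_univ _⟩
  have hcard : ((Finset.univ.erase a).erase b).card = k := by
    rw [Finset.card_erase_of_mem hb, Finset.card_erase_of_mem (Finset.mem_univ _),
      Finset.card_univ, hk]
    rfl
  have hT : ∀ S ∈ ((Finset.univ.erase a).erase b).powerset, a ∉ S ∧ b ∉ S := fun S hS =>
    ⟨fun h => by simpa using Finset.mem_powerset.1 hS h,
      fun h => by simpa using Finset.mem_powerset.1 hS h⟩
  have hfnot : ∀ S ∈ ((Finset.univ.erase a).erase b).powerset, 0 < S.card →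
      f S = if S.card ≤ 1 then ((k + 1).factorial : ℚ) ^ 2 else 0 := fun S hS hpos => by
    rw [hf, two_mul_sum_sameCycle_mul_restrictSign_notMem hab (hT S hS).1 (hT S hS).2
      (Finset.card_pos.1 hpos), hk]
    rfl
  rw [hsum, ← Finset.insert_erase hb, Finset.sum_powerset_insert (Finset.notMem_erase _ _),
    sum_powerset_of_card_le_one]
  · have hsingle : ∀ z ∈ (Finset.univ.erase a).erase b,
        (-1 : ℚ) ^ ({z} : Finset α).card * f {z} = -((k + 1).factorial : ℚ) ^ 2 := fun z hz => by
      rw [hfnot {z} (Finset.mem_powerset.2 (Finset.singleton_subset_iff.2 hz)) (by simp)]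
      simp
    have hmem : ∀ S ∈ ((Finset.univ.erase a).erase b).powerset,
        (-1 : ℚ) ^ (insert b S).card * f (insert b S) =
        (-1) ^ (S.card + 1) * ((S.card.factorial : ℚ) ^ 2 * (k - S.card).factorial *
          (k + 2 - S.card).factorial) := fun S hS => by
      have hle : S.card ≤ k := hcard ▸ Finset.card_le_card (Finset.mem_powerset.1 hS)
      rw [hf, two_mul_sum_sameCycle_mul_restrictSign_mem (S := insert b S)
        (by simp [hab, (hT S hS).1]) (Finset.mem_insert_self _ _),
        Finset.card_insert_of_notMem (hT S hS).2, hk, Nat.add_sub_cancel,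
        show k + 2 - (S.card + 1) - 1 = k - S.card by omega,
        show k + 2 - (S.card + 1) + 1 = k + 2 - S.card by omega]
    rw [Finset.sum_congr rfl hsingle, Finset.sum_congr rfl hmem,
      Finset.sum_powerset_apply_card fun j => (-1 : ℚ) ^ (j + 1) *
        ((j.factorial : ℚ) ^ 2 * (k - j).factorial * (k + 2 - j).factorial), hcard, hempty,
      Finset.sum_const, hcard, Finset.mul_sum, sub_eq_add_neg _ (∑ _ ∈ _, _),
      ← Finset.sum_neg_distrib]
    congr 1
    · simp
      ring
    · refine Finset.sum_congr rfl fun j hj => ?_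
      rw [← Nat.choose_mul_factorial_mul_factorial (Nat.lt_succ_iff.1 (Finset.mem_range.1 hj))]
      push_cast
      ring
  · intro S hS hc
    rw [hfnot S (Finset.mem_powerset.2 hS) (by omega), if_neg (by omega), mul_zero]

theorem two_mul_card_isFullCycle_sameCycle {a b : α} (hab : a ≠ b) {k : ℕ}
    (hk : Fintype.card α = k + 2) :
    2 * ((Finset.univ.filter fun p : Perm α × Perm α =>
      IsFullCycle p.1 ∧ IsFullCycle p.2 ∧ (p.1 * p.2).SameCycle a b).card : ℚ) =
      ((k + 1).factorial : ℚ) * (k + 2).factorial - k * ((k + 1).factorial : ℚ) ^ 2 -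
        k.factorial * ∑ j ∈ Finset.range (k + 1),
          (-1) ^ j * ((j.factorial : ℚ) * (k + 2 - j).factorial) := by
  rw [← two_mul_sum_sameCycle_isFullCycle hab hk, ← Finset.sum_boole, Fintype.sum_prod_type]
  simp_rw [Finset.mul_sum]
  symm
  rw [Finset.sum_comm]
  symm
  refine Finset.sum_congr rfl fun u _ => ?_
  rw [← Equiv.sum_comp (Equiv.mulLeft u⁻¹)]
  refine Finset.sum_congr rfl fun w _ => ?_
  rw [Equiv.coe_mulLeft, mul_inv_cancel_left]
  split_ifs <;> simp_all

theorem eq_of_two_mul_eq_alternating_sum (k : ℕ) {N : ℚ}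
    (hN : 2 * N = ((k + 1).factorial : ℚ) * (k + 2).factorial - k * ((k + 1).factorial : ℚ) ^ 2 -
      k.factorial * ∑ j ∈ Finset.range (k + 1),
        (-1) ^ j * ((j.factorial : ℚ) * (k + 2 - j).factorial)) :
    N = ((k + 1).factorial : ℚ) ^ 2 *
      if Odd k then 1 / 2 else 1 / 2 - 2 / (((k : ℚ) + 1) * (k + 4)) := by
  have hT := alternating_sum_factorial_mul_factorial (k + 2) (k + 1) (by omega)
  generalize ∑ j ∈ Finset.range (k + 1), (-1 : ℚ) ^ j *
    ((j.factorial : ℚ) * (k + 2 - j).factorial) = T at hN hT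
  rw [show k + 2 + 1 - (k + 1) = 2 by omega] at hT
  simp only [Nat.factorial_succ, Nat.factorial_zero] at hN hT ⊢
  push_cast at hN hT ⊢
  generalize (k.factorial : ℚ) = F at hN hT ⊢
  have h1 : (k : ℚ) + 1 ≠ 0 := by positivity
  have h4 : (k : ℚ) + 4 ≠ 0 := by positivity
  rcases Nat.even_or_odd k with hk | hk
  · rw [if_neg (Nat.not_odd_iff_even.2 hk)]
    rw [pow_succ, hk.neg_one_pow] at hT
    field_simp
    linear_combination ((k : ℚ) + 4) * hN - F * hT
  · rw [if_pos hk]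
    rw [pow_succ, hk.neg_one_pow] at hT
    field_simp
    apply mul_left_cancel₀ h4
    linear_combination ((k : ℚ) + 4) * hN - F * hT

end

theorem prob_same_cycle_two (n : ℕ) (hn : 2 ≤ n) :
    ((Finset.univ.filter (fun p : Perm (Fin n) × Perm (Fin n) =>
        (p.1.IsCycle ∧ p.1.support = Finset.univ) ∧
        (p.2.IsCycle ∧ p.2.support = Finset.univ) ∧
        (p.1 * p.2).SameCycle ⟨0, by omega⟩ ⟨1, by omega⟩)).card : ℚ) =
      ((n - 1).factorial : ℚ) ^ 2 *
        (if Odd n then 1 / 2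
         else 1 / 2 - 2 / (((n : ℚ) - 1) * ((n : ℚ) + 2))) := by
  obtain ⟨k, rfl⟩ := Nat.exists_eq_add_of_le' hn
  have h := eq_of_two_mul_eq_alternating_sum k (two_mul_card_isFullCycle_sameCycle
    (α := Fin (k + 2)) (a := ⟨0, by omega⟩) (b := ⟨1, by omega⟩) (by simp) (Fintype.card_fin _))
  simp only [isFullCycle_iff] at h
  have hodd : Odd (k + 2) ↔ Odd k := by simp [Nat.odd_add]
  have hden : (((k + 2 : ℕ) : ℚ) - 1) * (((k + 2 : ℕ) : ℚ) + 2) = (k + 1) * (k + 4) := by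
    push_cast
    ring
  rw [if_congr hodd rfl rfl, hden, show k + 2 - 1 = k + 1 by omega]
  convert h
end
end

section
/- For n ≥ 3, the number of pairs (u,v) of n-cycles in S_n such that 1, 2, and 3 all lie in the same cycle of uv equals ((n-1)!)^2 times (1/3 + 1/((n-2)(n+3)) if n is odd, and 1/3 - 3/((n-1)(n+2)) if n is even). -/
open Equiv Finset

section

open Polynomial

variable {α : Type*} [DecidableEq α]

/-- The matrix `(1 - X) • 1 + X • P`, where `P` is the permutation matrix of `w`. -/
noncomputable def permPencil (w : Perm α) : Matrix α α ℚ[X] :=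
  Matrix.of fun i j => (if i = j then 1 - X else 0) + if w i = j then X else 0

theorem permPencil_row (w : Perm α) (i : α) :
    permPencil w i = (1 - X : ℚ[X]) • Pi.single i 1 + (X : ℚ[X]) • Pi.single (w i) 1 := by
  ext1 j
  simp [permPencil, Pi.single_apply, eq_comm]

/-- The block diagonal matrix with blocks `1` and `B`, indexed by `Option α`. -/
noncomputable def optionBlock (B : Matrix α α ℚ[X]) : Matrix (Option α) (Option α) ℚ[X] :=
  (Matrix.fromBlocks B 0 0 (1 : Matrix Unit Unit ℚ[X])).submatrix
    (optionEquivSumPUnit α) (optionEquivSumPUnit α)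

theorem permPencil_optionCongr (w : Perm α) :
    permPencil (optionCongr w) = optionBlock (permPencil w) := by
  refine Matrix.ext fun i j => ?_
  cases i <;> cases j <;> simp [permPencil, optionBlock]

variable [Fintype α]

theorem permPencil_mulVec_one (w : Perm α) : (permPencil w).mulVec 1 = 1 := by
  ext1 i
  simp [permPencil, Matrix.mulVec, dotProduct, sum_add_distrib]

theorem one_vecMul_permPencil (w : Perm α) : Matrix.vecMul 1 (permPencil w) = 1 := by
  ext1 j
  have h : ∀ i, w i = j ↔ i = w.symm j := fun i => by rw [Equiv.eq_symm_apply]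
  simp [permPencil, Matrix.vecMul, dotProduct, sum_add_distrib, h]

theorem sum_adjugate_permPencil_row (w : Perm α) (a : α) :
    ∑ i, (permPencil w).adjugate a i = (permPencil w).det := by
  have h := congrArg (fun v => (permPencil w).adjugate.mulVec v a) (permPencil_mulVec_one w)
  rw [Matrix.mulVec_mulVec, Matrix.adjugate_mul] at h
  simpa [Matrix.mulVec, dotProduct, Matrix.one_apply] using h.symm

theorem sum_adjugate_permPencil_col (w : Perm α) (a : α) :
    ∑ i, (permPencil w).adjugate i a = (permPencil w).det := by
  have h := congrArg (fun v => Matrix.vecMul v (permPencil w).adjugate a) (one_vecMul_permPencil w)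
  rw [Matrix.vecMul_vecMul, Matrix.mul_adjugate] at h
  simpa [Matrix.vecMul, dotProduct, Matrix.one_apply] using h.symm

theorem Matrix.derivative_det {R : Type*} [CommRing R] (A : Matrix α α R[X]) :
    derivative A.det = ∑ i, (A.updateRow i fun j => derivative (A i j)).det := by
  simp only [Matrix.det_apply, derivative_sum]
  rw [sum_comm]
  refine sum_congr rfl fun σ _ => ?_
  rw [← smul_sum, Units.smul_def, Units.smul_def, derivative_smul]
  congr 1
  rw [derivative_prod_finset]
  conv_rhs => rw [← Equiv.sum_comp σ]
  refine sum_congr rfl fun k _ => ?_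
  rw [← prod_erase_mul _ _ (mem_univ k), Matrix.updateRow_self]
  congr 1
  refine prod_congr rfl fun l hl => ?_
  rw [Matrix.updateRow_ne (σ.injective.ne (ne_of_mem_erase hl))]

theorem det_updateRow_single_sub (A : Matrix α α ℚ[X]) (i a b : α) :
    (A.updateRow i (Pi.single a 1 - Pi.single b 1)).det = A.adjugate a i - A.adjugate b i := by
  rw [sub_eq_add_neg, Matrix.det_updateRow_add, ← neg_one_smul ℚ[X], Matrix.det_updateRow_smul,
    Matrix.adjugate_apply, Matrix.adjugate_apply]
  ring

theorem derivative_det_permPencil (w : Perm α) :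
    derivative (permPencil w).det =
      ∑ i, (permPencil w).adjugate (w i) i - (permPencil w).adjugate.trace := by
  rw [Matrix.derivative_det, Matrix.trace, ← sum_sub_distrib]
  refine sum_congr rfl fun i _ => ?_
  rw [Matrix.diag_apply, ← det_updateRow_single_sub]
  congr 2
  ext1 j
  simp only [permPencil, Matrix.of_apply, Pi.sub_apply, Pi.single_apply, eq_comm (a := j)]
  split_ifs <;> simp

theorem X_mul_sum_adjugate_permPencil (w : Perm α) :
    X * ∑ i, (permPencil w).adjugate (w i) i =
      (Fintype.card α : ℚ[X]) * X * (permPencil w).det +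
        X * (1 - X) * derivative (permPencil w).det := by
  have h := congrArg Matrix.trace (Matrix.mul_adjugate (permPencil w))
  have h2 : (permPencil w * (permPencil w).adjugate).trace =
      (1 - X) * (permPencil w).adjugate.trace + X * ∑ i, (permPencil w).adjugate (w i) i := by
    simp only [Matrix.trace, Matrix.diag_apply, Matrix.mul_apply, mul_sum, ← sum_add_distrib]
    refine sum_congr rfl fun i _ => ?_
    simp [permPencil, add_mul, sum_add_distrib]
  rw [h2, Matrix.trace_smul, Matrix.trace_one, smul_eq_mul] at h
  rw [derivative_det_permPencil]
  linear_combination X * h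

theorem det_permPencil_swap_mul (w : Perm α) (a c : α) :
    (permPencil (swap a c * w)).det = (permPencil w).det +
      X * ((permPencil w).adjugate a (w.symm c) - (permPencil w).adjugate c (w.symm c) -
        (permPencil w).adjugate a (w.symm a) + (permPencil w).adjugate c (w.symm a)) := by
  rcases eq_or_ne a c with rfl | hac
  · rw [swap_self, ← Perm.one_def, one_mul]
    ring
  set A := permPencil w
  have hij : w.symm a ≠ w.symm c := fun h => hac (w.symm.injective h)
  set v : α → ℚ[X] := Pi.single a 1 - Pi.single c 1
  have h : permPencil (swap a c * w) =
      (A.updateRow (w.symm c) (A (w.symm c) + (X : ℚ[X]) • v)).updateRow (w.symm a)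
        (A (w.symm a) + (-X : ℚ[X]) • v) := by
    refine funext fun i => ?_
    by_cases h1 : i = w.symm a
    · subst h1
      simp only [A, v, Matrix.updateRow_self, permPencil_row, Perm.mul_apply, apply_symm_apply,
        swap_apply_left]
      refine funext fun j => ?_
      simp only [Pi.add_apply, Pi.smul_apply, Pi.sub_apply, smul_eq_mul]
      ring
    rw [Matrix.updateRow_ne h1]
    by_cases h2 : i = w.symm c
    · subst h2
      simp only [A, v, Matrix.updateRow_self, permPencil_row, Perm.mul_apply, apply_symm_apply,
        swap_apply_right]
      refine funext fun j => ?_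
      simp only [Pi.add_apply, Pi.smul_apply, Pi.sub_apply, smul_eq_mul]
      ring
    rw [Matrix.updateRow_ne h2]
    simp only [A, permPencil_row, Perm.mul_apply]
    rw [swap_apply_of_ne_of_ne]
    · rwa [ne_eq, ← Equiv.eq_symm_apply]
    · rwa [ne_eq, ← Equiv.eq_symm_apply]
  rw [h, Matrix.det_updateRow_add, Matrix.det_updateRow_smul,
    Matrix.updateRow_comm _ hij.symm, Matrix.updateRow_comm _ hij.symm,
    Matrix.det_updateRow_add, Matrix.det_updateRow_smul,
    Matrix.det_updateRow_add, Matrix.det_updateRow_smul]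
  have h3 : ((A.updateRow (w.symm a) v).updateRow (w.symm c) v).det = 0 :=
    Matrix.det_zero_of_row_eq hij (by
      rw [Matrix.updateRow_self, Matrix.updateRow_ne hij, Matrix.updateRow_self])
  have h4 : A.updateRow (w.symm c) (A (w.symm c)) = A := Matrix.updateRow_eq_self _ _
  have h5 : A.updateRow (w.symm a) (A (w.symm a)) = A := Matrix.updateRow_eq_self _ _
  have h6 : (A.updateRow (w.symm a) v).updateRow (w.symm c) (A (w.symm c)) =
      A.updateRow (w.symm a) v := by
    rw [Matrix.updateRow_comm _ hij, h4]
  rw [h5, h3, h6, h4, det_updateRow_single_sub, det_updateRow_single_sub]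
  ring

theorem det_optionBlock (B : Matrix α α ℚ[X]) : (optionBlock B).det = B.det := by
  rw [optionBlock, Matrix.det_submatrix_equiv_self, Matrix.det_fromBlocks_zero₁₂]
  simp

theorem det_permPencil_optionCongr (w : Perm α) :
    (permPencil (optionCongr w)).det = (permPencil w).det := by
  rw [permPencil_optionCongr, det_optionBlock]

theorem det_permPencil_swap_none_mul (w : Perm α) (c : α) :
    (permPencil (swap none (some c) * optionCongr w)).det =
      (1 - X) * (permPencil w).det - X * (permPencil w).adjugate c (w.symm c) := by
  rw [det_permPencil_swap_mul]
  simp only [← optionCongr_symm, optionCongr_apply, Option.map_some, Option.map_none]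
  rw [permPencil_optionCongr, det_optionBlock]
  have h1 : (optionBlock (permPencil w)).adjugate none (some (w.symm c)) = 0 := by
    rw [Matrix.adjugate_apply]
    refine Matrix.det_zero_of_row_eq (i := none) (j := some (w.symm c)) (by simp) ?_
    rw [Matrix.updateRow_self, Matrix.updateRow_ne (by simp)]
    ext1 j
    cases j <;> simp [optionBlock]
  have h2 : (optionBlock (permPencil w)).adjugate (some c) none = 0 := by
    rw [Matrix.adjugate_apply]
    refine Matrix.det_eq_zero_of_column_eq_zero none fun i => ?_
    cases i <;> simp [optionBlock]
  have h3 : (optionBlock (permPencil w)).adjugate none none = (permPencil w).det := by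
    rw [Matrix.adjugate_apply, ← det_optionBlock (permPencil w)]
    congr 1
    refine Matrix.ext fun i j => ?_
    cases i <;> cases j <;> simp [optionBlock]
  have h4 : (optionBlock (permPencil w)).adjugate (some c) (some (w.symm c)) =
      (permPencil w).adjugate c (w.symm c) := by
    rw [Matrix.adjugate_apply, Matrix.adjugate_apply,
      ← det_optionBlock ((permPencil w).updateRow (w.symm c) (Pi.single c 1))]
    congr 1
    refine Matrix.ext fun i j => ?_
    cases i <;> cases j <;> simp [optionBlock, Matrix.updateRow_apply, Pi.single_apply]
  rw [h1, h2, h3, h4]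
  ring

theorem sum_det_permPencil_swap_mul (w : Perm α) (c : α) :
    ∑ a ∈ univ.erase c, (permPencil (swap a c * w)).det =
      (Fintype.card α : ℚ[X]) * (permPencil (swap none (some c) * optionCongr w)).det -
        derivative (X * (1 - X) * (permPencil w).det) := by
  have h : ∑ a, (permPencil (swap a c * w)).det =
      ((Fintype.card α : ℚ[X]) + 2 * X) * (permPencil w).det -
        (Fintype.card α : ℚ[X]) * X * (permPencil w).adjugate c (w.symm c) -
        X * ∑ i, (permPencil w).adjugate (w i) i := by
    simp only [det_permPencil_swap_mul, sum_add_distrib, ← mul_sum, sum_sub_distrib,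
      sum_adjugate_permPencil_col]
    rw [← Equiv.sum_comp w (fun a => (permPencil w).adjugate a (w.symm a)),
      Equiv.sum_comp w.symm (fun a => (permPencil w).adjugate c a), sum_adjugate_permPencil_row]
    simp
    ring
  rw [X_mul_sum_adjugate_permPencil] at h
  rw [← add_sum_erase _ _ (mem_univ c), swap_self] at h
  rw [det_permPencil_swap_none_mul]
  simp only [derivative_mul, derivative_sub, derivative_one, derivative_X]
  have h' : (permPencil (Equiv.refl α * w)).det = (permPencil w).det := rfl
  rw [h'] at h
  linear_combination h

theorem det_permPencil_permCongr {β : Type*} [Fintype β] [DecidableEq β] (e : α ≃ β)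
    (w : Perm α) : (permPencil (e.permCongr w)).det = (permPencil w).det := by
  rw [← Matrix.det_reindex_self e (permPencil w)]
  congr 1
  refine Matrix.ext fun i j => ?_
  simp [permPencil, Equiv.eq_symm_apply]
  congr

end

section

open Polynomial

/-- The linear functional `p ↦ ∫₀¹ p`. -/
noncomputable def unitIntegral : ℚ[X] →ₗ[ℚ] ℚ :=
  Polynomial.lsum fun k => (1 / (k + 1 : ℚ)) • LinearMap.id

theorem unitIntegral_monomial (k : ℕ) (a : ℚ) :
    unitIntegral (monomial k a) = a / (k + 1) := by
  simp [unitIntegral, Polynomial.lsum, div_eq_inv_mul]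

theorem unitIntegral_X_pow (k : ℕ) : unitIntegral (X ^ k) = 1 / (k + 1) := by
  rw [X_pow_eq_monomial, unitIntegral_monomial]

theorem unitIntegral_derivative (p : ℚ[X]) :
    unitIntegral (derivative p) = p.eval 1 - p.eval 0 := by
  induction p using Polynomial.induction_on' with
  | add p q hp hq => simp only [map_add, hp, hq, eval_add]; ring
  | monomial k a =>
    rw [derivative_monomial, unitIntegral_monomial]
    cases k with
    | zero => simp
    | succ k =>
      have : (k : ℚ) + 1 ≠ 0 := by positivity
      simp [this]

theorem unitIntegral_one_sub_X_pow (k : ℕ) : unitIntegral ((1 - X) ^ k) = 1 / (k + 1) := by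
  have h := unitIntegral_derivative ((1 - X) ^ (k + 1))
  have h2 : derivative ((1 - X : ℚ[X]) ^ (k + 1)) = (-(k + 1 : ℚ)) • (1 - X) ^ k := by
    simp [derivative_pow, smul_eq_C_mul]
    ring
  have : (k : ℚ) + 1 ≠ 0 := by positivity
  rw [h2, map_smul] at h
  simp at h
  field_simp
  linear_combination -h

end

namespace Equiv.Perm

variable {α β : Type*}

theorem SameCycle.map {σ : Perm α} {τ : Perm β} {f : α → β}
    (hf : ∀ x, τ.SameCycle (f x) (f (σ x))) {x y : α} (h : σ.SameCycle x y) :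
    τ.SameCycle (f x) (f y) := by
  obtain ⟨i, rfl⟩ := h
  induction i using Int.induction_on with
  | zero => rfl
  | succ i ih =>
    rw [add_comm, zpow_add, zpow_one, mul_apply]
    exact ih.trans (hf _)
  | pred i ih =>
    refine ih.trans (SameCycle.symm ?_)
    have h := hf ((σ ^ (-(i : ℤ) - 1)) x)
    rwa [← mul_apply σ, ← zpow_one_add, add_sub_cancel] at h

theorem sameCycle_permCongr (e : α ≃ β) (w : Perm α) (x y : α) :
    (e.permCongr w).SameCycle (e x) (e y) ↔ w.SameCycle x y := by
  refine ⟨fun h => ?_, SameCycle.map fun z => ⟨1, by simp⟩⟩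
  simpa using h.map (f := e.symm) (τ := w) fun z => ⟨1, by simp⟩

/-- All points lie in a single cycle of `w`. -/
def IsTransitive (w : Perm α) : Prop := ∀ x y, w.SameCycle x y

theorem isTransitive_permCongr (e : α ≃ β) (w : Perm α) :
    (e.permCongr w).IsTransitive ↔ w.IsTransitive := by
  simp only [IsTransitive, ← e.forall_congr_right, sameCycle_permCongr]

theorem not_isTransitive_optionCongr [Nonempty α] (w : Perm α) :
    ¬ IsTransitive (optionCongr w) := by
  intro h
  obtain ⟨i, hi⟩ := h none (some (Classical.arbitrary α))
  rw [zpow_apply_eq_self_of_apply_eq_self (by simp)] at hi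
  simp at hi

theorem optionCongr_mul (u v : Perm α) :
    (optionCongr (u * v) : Perm (Option α)) = optionCongr u * optionCongr v :=
  Equiv.ext fun x => by cases x <;> rfl

theorem optionCongr_inv (u : Perm α) :
    (optionCongr u⁻¹ : Perm (Option α)) = (optionCongr u)⁻¹ :=
  optionCongr_symm u

open scoped Classical in
/-- The indicator function of the transitive permutations. -/
noncomputable def transitiveIndicator (w : Perm α) : ℚ := if w.IsTransitive then 1 else 0

theorem transitiveIndicator_congr {u : Perm α} {v : Perm β}
    (h : u.IsTransitive ↔ v.IsTransitive) : u.transitiveIndicator = v.transitiveIndicator := by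
  by_cases hv : v.IsTransitive <;> simp [transitiveIndicator, h, hv]

theorem transitiveIndicator_permCongr (e : α ≃ β) (w : Perm α) :
    (e.permCongr w).transitiveIndicator = w.transitiveIndicator :=
  transitiveIndicator_congr (isTransitive_permCongr e w)

theorem transitiveIndicator_optionCongr [Nonempty α] (w : Perm α) :
    transitiveIndicator (optionCongr w) = 0 :=
  if_neg (not_isTransitive_optionCongr w)

variable [DecidableEq α]

theorem sameCycle_swap_none_mul_optionCongr (i : Option α) (w : Perm α) (x y : α) :
    (swap none i * optionCongr w).SameCycle (some x) (some y) ↔ w.SameCycle x y := by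
  constructor
  · intro h
    refine h.map (f := fun p => p.getD (i.elim x w.symm)) fun p => ?_
    rcases p with _ | z
    · rcases i with _ | a
      · simp [SameCycle.refl]
      · exact ⟨1, by simp⟩
    · rcases i with _ | a
      · exact ⟨1, by simp⟩
      · rcases eq_or_ne (w z) a with rfl | h
        · simp [SameCycle.refl]
        · refine ⟨1, ?_⟩
          simp [swap_apply_of_ne_of_ne, h]
  · refine SameCycle.map (f := some) fun z => ?_
    by_cases h : i = some (w z)
    · subst h
      exact ⟨2, by simp [zpow_ofNat, pow_two]⟩
    · exact ⟨1, by simp [swap_apply_of_ne_of_ne, Ne.symm h]⟩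

theorem isTransitive_swap_none_mul_optionCongr (a : α) (w : Perm α) :
    (swap none (some a) * optionCongr w).IsTransitive ↔ w.IsTransitive := by
  refine ⟨fun h x y => (sameCycle_swap_none_mul_optionCongr _ _ _ _).1 (h (some x) (some y)),
    fun h => ?_⟩
  have key : ∀ p, (swap none (some a) * optionCongr w).SameCycle (some a) p := by
    rintro (_ | x)
    · exact SameCycle.symm ⟨1, by simp⟩
    · exact (sameCycle_swap_none_mul_optionCongr _ _ _ _).2 (h a x)
  exact fun p q => (key p).symm.trans (key q)

theorem isTransitive_iff [Fintype α] [Nontrivial α] (w : Perm α) :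
    w.IsTransitive ↔ w.IsCycle ∧ w.support = Finset.univ := by
  constructor
  · intro h
    have hne : ∀ x, w x ≠ x := by
      intro x hx
      obtain ⟨y, hy⟩ := exists_ne x
      obtain ⟨i, hi⟩ := h x y
      rw [zpow_apply_eq_self_of_apply_eq_self hx] at hi
      exact hy hi.symm
    obtain ⟨x⟩ : Nonempty α := inferInstance
    exact ⟨⟨x, hne x, fun y _ => h x y⟩, Finset.eq_univ_of_forall fun y => by simp [hne]⟩
  · rintro ⟨h, hs⟩ x y
    have hne : ∀ x, w x ≠ x := fun x => by
      rw [← mem_support, hs]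
      exact Finset.mem_univ x
    exact h.sameCycle (hne x) (hne y)

theorem inv_optionCongr_mul_swap (u w : Perm α) (a : α) :
    (optionCongr u)⁻¹ * (swap none (some a) * optionCongr w) =
      swap none (some (u⁻¹ a)) * optionCongr (u⁻¹ * w) := by
  rw [← mul_assoc, mul_swap_eq_swap_mul, mul_assoc, optionCongr_mul, ← optionCongr_inv]
  simp

theorem sum_option [Fintype α] {M : Type*} [AddCommMonoid M] (f : Perm (Option α) → M) :
    ∑ w, f w = ∑ w : Perm α, f (optionCongr w) +
      ∑ a, ∑ w : Perm α, f (swap none (some a) * optionCongr w) := by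
  rw [← decomposeOption.symm.sum_comp, Fintype.sum_prod_type, Fintype.sum_option]
  simp [decomposeOption, one_def.symm]

theorem transitiveIndicator_swap_none_mul_optionCongr (a : α) (w : Perm α) :
    (swap none (some a) * optionCongr w).transitiveIndicator = w.transitiveIndicator :=
  transitiveIndicator_congr (isTransitive_swap_none_mul_optionCongr a w)

/-- The number of ways of writing `w` as a product of two transitive permutations. -/
noncomputable def factorizationCount [Fintype α] (w : Perm α) : ℚ :=
  ∑ u : Perm α, u.transitiveIndicator * (u⁻¹ * w).transitiveIndicator

theorem factorizationCount_permCongr [Fintype α] [Fintype β] [DecidableEq β] (e : α ≃ β)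
    (w : Perm α) : (e.permCongr w).factorizationCount = w.factorizationCount := by
  rw [factorizationCount, ← e.permCongr.sum_comp]
  refine Finset.sum_congr rfl fun u _ => ?_
  have h : (e.permCongr u)⁻¹ * e.permCongr w = e.permCongr (u⁻¹ * w) := by
    ext x
    rw [mul_apply, inv_eq_iff_eq]
    simp
  simp only [h, transitiveIndicator_permCongr]

theorem factorizationCount_optionCongr [Fintype α] [Nonempty α] (w : Perm α) :
    factorizationCount (optionCongr w) = Fintype.card α * w.factorizationCount := by
  simp only [factorizationCount, sum_option, transitiveIndicator_optionCongr, zero_mul,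
    Finset.sum_const_zero, zero_add, transitiveIndicator_swap_none_mul_optionCongr, mul_inv_rev,
    swap_inv, mul_assoc, inv_optionCongr_mul_swap]
  simp

theorem factorizationCount_swap_none_mul [Fintype α] [Nonempty α] (w : Perm α) (c : α) :
    (swap none (some c) * optionCongr w).factorizationCount =
      ∑ a ∈ Finset.univ.erase c, (swap a c * w).factorizationCount := by
  simp only [factorizationCount, sum_option, transitiveIndicator_optionCongr, zero_mul,
    Finset.sum_const_zero, zero_add, transitiveIndicator_swap_none_mul_optionCongr, mul_inv_rev,
    swap_inv]
  rw [← Finset.add_sum_erase _ _ (Finset.mem_univ c)]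
  have h0 : ∀ u : Perm α, transitiveIndicator ((optionCongr u)⁻¹ * swap none (some c) *
      (swap none (some c) * optionCongr w)) = 0 := by
    intro u
    rw [mul_assoc, swap_mul_self_mul, ← optionCongr_inv, ← optionCongr_mul]
    exact transitiveIndicator_optionCongr _
  simp only [h0, mul_zero, Finset.sum_const_zero, zero_add]
  refine Finset.sum_congr rfl fun a ha => Finset.sum_congr rfl fun u _ => ?_
  have hac := Finset.ne_of_mem_erase ha
  have h : swap none (some a) * swap none (some c) =
      (swap none (some c) * optionCongr (swap a c) : Perm (Option α)) := by
    rw [optionCongr_swap, mul_swap_eq_swap_mul (swap none (some c)), swap_apply_right,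
      swap_apply_of_ne_of_ne (by simp) (by simpa using hac), swap_comm (some a) none]
  rw [mul_assoc, ← mul_assoc (swap none (some a)), h, mul_assoc (swap none (some c)),
    ← optionCongr_mul, inv_optionCongr_mul_swap, transitiveIndicator_swap_none_mul_optionCongr]

theorem factorizationCount_eq (n : ℕ) (w : Perm (Fin (n + 1))) :
    w.factorizationCount = n.factorial * unitIntegral (permPencil w).det := by
  induction n with
  | zero =>
    have : Subsingleton (Fin (0 + 1)) := Fin.subsingleton_one
    have h : ∀ u : Perm (Fin (0 + 1)), u.IsTransitive :=
      fun u x y => (Subsingleton.elim x y) ▸ SameCycle.refl _ _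
    have h2 := unitIntegral_X_pow 0
    simp [factorizationCount, transitiveIndicator, h, permPencil,
      Subsingleton.elim (w 0) 0] at h2 ⊢
    exact h2.symm
  | succ n ih =>
    obtain ⟨v, rfl⟩ := (finSuccEquivLast (n := n + 1)).symm.permCongr.surjective w
    obtain ⟨⟨i, u⟩, rfl⟩ := decomposeOption.symm.surjective v
    rw [factorizationCount_permCongr, det_permPencil_permCongr]
    rcases i with _ | c
    · have h : decomposeOption.symm (none, u) = optionCongr u := by
        simp [decomposeOption, one_def.symm]
      rw [h, factorizationCount_optionCongr, ih, det_permPencil_optionCongr, Fintype.card_fin,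
        Nat.factorial_succ]
      push_cast
      ring
    · have h : decomposeOption.symm (some c, u) = swap none (some c) * optionCongr u := rfl
      have hI := congrArg unitIntegral (sum_det_permPencil_swap_mul u c)
      rw [map_sum, map_sub, unitIntegral_derivative, ← Polynomial.C_eq_natCast,
        ← Polynomial.smul_eq_C_mul, map_smul, smul_eq_mul,
        Fintype.card_fin] at hI
      simp only [Polynomial.eval_mul, Polynomial.eval_sub, Polynomial.eval_X, Polynomial.eval_one,
        sub_self, mul_zero, zero_mul, sub_zero] at hI
      rw [h, factorizationCount_swap_none_mul]
      simp only [ih, ← Finset.mul_sum, hI, Nat.factorial_succ]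
      push_cast
      ring

end Equiv.Perm

section

open Polynomial

variable {α β : Type*} [Fintype α] [DecidableEq α] [Fintype β] [DecidableEq β]

/-- The sum of `(permPencil w).det` over all `w` having `x`, `y`, `z` in the same cycle. -/
noncomputable def sameCycleSum (x y z : α) : ℚ[X] :=
  ∑ w : Perm α with w.SameCycle x y ∧ w.SameCycle x z, (permPencil w).det

theorem sameCycleSum_equiv (e : α ≃ β) (x y z : α) :
    sameCycleSum (e x) (e y) (e z) = sameCycleSum x y z := by
  simp only [sameCycleSum, sum_filter]
  rw [← e.permCongr.sum_comp]
  simp only [Perm.sameCycle_permCongr, det_permPencil_permCongr]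

theorem sameCycleSum_some (x y z : α) :
    sameCycleSum (some x) (some y) (some z) =
      (1 + (Fintype.card α : ℚ[X]) * (1 - 2 * X)) * sameCycleSum x y z -
        X * (1 - X) * derivative (sameCycleSum x y z) := by
  have h1 : ∀ (w : Perm α) (a b : α),
      Perm.SameCycle (optionCongr w) (some a) (some b) ↔ w.SameCycle a b := fun w a b => by
    have h := Perm.sameCycle_swap_none_mul_optionCongr none w a b
    rwa [swap_self, ← Perm.one_def, one_mul] at h
  simp only [sameCycleSum, derivative_sum, mul_sum, ← sum_sub_distrib]
  rw [sum_filter, Perm.sum_option, sum_comm, ← sum_add_distrib, sum_filter]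
  refine sum_congr rfl fun w _ => ?_
  simp only [h1, Perm.sameCycle_swap_none_mul_optionCongr]
  split_ifs
  · simp only [det_permPencil_optionCongr, det_permPencil_swap_none_mul, sum_sub_distrib,
      ← mul_sum]
    rw [← Equiv.sum_comp w (fun c => (permPencil w).adjugate c (w.symm c))]
    simp only [symm_apply_apply, X_mul_sum_adjugate_permPencil]
    simp
    ring
  · simp

theorem sameCycleSum_fin_three :
    sameCycleSum (0 : Fin 3) 1 2 = 2 * (1 - X) ^ 3 + 2 * X ^ 3 := by
  have h : ({w | w.SameCycle 0 1 ∧ w.SameCycle 0 2} : Finset (Perm (Fin 3))) =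
      {finRotate 3, (finRotate 3)⁻¹} := by decide
  have h' : finRotate 3 ≠ (finRotate 3)⁻¹ := by decide
  have r0 : finRotate 3 0 = 1 := by decide
  have r1 : finRotate 3 1 = 2 := by decide
  have r2 : finRotate 3 2 = 0 := by decide
  have s0 : (finRotate 3)⁻¹ 0 = 2 := by decide
  have s1 : (finRotate 3)⁻¹ 1 = 0 := by decide
  have s2 : (finRotate 3)⁻¹ 2 = 1 := by decide
  rw [sameCycleSum, h, sum_pair h', Matrix.det_fin_three, Matrix.det_fin_three]
  simp only [permPencil, Matrix.of_apply, r0, r1, r2, s0, s1, s2]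
  simp
  ring

theorem three_mul_sameCycleSum_fin (m : ℕ) :
    3 * sameCycleSum (⟨0, by omega⟩ : Fin (m + 3)) ⟨1, by omega⟩ ⟨2, by omega⟩ =
      (m.factorial : ℚ[X]) * (((m : ℚ[X]) + 1) * ((m : ℚ[X]) + 2) *
        (((m : ℚ[X]) + 3) * (1 - X) ^ (m + 3) + (m : ℚ[X]) * X * (1 - X) ^ (m + 2)) +
        6 * X ^ 3 * (1 - X) ^ (m + 2) + 6 * (-X) ^ (m + 4) * ((m : ℚ[X]) + 2 - X)) := by
  induction m with
  | zero =>
    have h := sameCycleSum_fin_three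
    simp at h ⊢
    linear_combination 3 * h
  | succ m ih =>
    have h := sameCycleSum_equiv (finSuccEquivLast (n := m + 3)).symm (some ⟨0, by omega⟩)
      (some ⟨1, by omega⟩) (some ⟨2, by omega⟩)
    rw [sameCycleSum_some] at h
    simp only [finSuccEquivLast_symm_some, Fin.castSucc_mk, Fintype.card_fin] at h
    have hd := congrArg derivative ih
    rw [h]
    simp only [derivative_mul, derivative_add, derivative_sub, derivative_pow, derivative_X,
      derivative_one, derivative_natCast, derivative_ofNat, derivative_neg, map_natCast] at hd
    simp only [Nat.factorial_succ]
    push_cast at hd ⊢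
    linear_combination (1 + (m + 3) * (1 - 2 * X)) * ih - X * (1 - X) * hd

theorem unitIntegral_sameCycleSum_fin (m : ℕ) :
    unitIntegral (sameCycleSum (⟨0, by omega⟩ : Fin (m + 3)) ⟨1, by omega⟩ ⟨2, by omega⟩) =
      m.factorial / 3 * ((m + 1) * (m + 2) * ((m + 3) / (m + 4) +
        m * (1 / (m + 3) - 1 / (m + 4))) + 6 * (1 / (m + 3) - 3 / (m + 4) + 3 / (m + 5) -
          1 / (m + 6)) + 6 * (-1) ^ m * ((m + 2) / (m + 5) - 1 / (m + 6))) := by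
  have h : sameCycleSum (⟨0, by omega⟩ : Fin (m + 3)) ⟨1, by omega⟩ ⟨2, by omega⟩ =
      (m.factorial / 3 : ℚ) • (((m + 1) * (m + 2) * (m + 3) : ℚ) • (1 - X) ^ (m + 3) +
        ((m + 1) * (m + 2) * m : ℚ) • ((1 - X) ^ (m + 2) - (1 - X) ^ (m + 3)) +
        (6 : ℚ) • ((1 - X) ^ (m + 2) - (3 : ℚ) • (1 - X) ^ (m + 3) +
          (3 : ℚ) • (1 - X) ^ (m + 4) - (1 - X) ^ (m + 5)) +
        (6 * (-1) ^ m : ℚ) • ((m + 2 : ℚ) • X ^ (m + 4) - X ^ (m + 5))) := by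
    have h3 : C (m.factorial / 3 : ℚ) * 3 = (m.factorial : ℚ[X]) := by
      rw [← C_ofNat, ← C_mul, div_mul_cancel₀ _ (by norm_num), C_eq_natCast]
    have h4 := three_mul_sameCycleSum_fin m
    refine mul_left_cancel₀ (by norm_num : (3 : ℚ[X]) ≠ 0) (h4.trans ?_)
    simp only [smul_eq_C_mul, C_mul, C_add, C_pow, C_neg, map_ofNat, C_1, map_natCast]
    rw [neg_pow (X : ℚ[X])]
    linear_combination -(((m : ℚ[X]) + 1) * ((m : ℚ[X]) + 2) *
      (((m : ℚ[X]) + 3) * (1 - X) ^ (m + 3) + (m : ℚ[X]) * X * (1 - X) ^ (m + 2)) +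
      6 * X ^ 3 * (1 - X) ^ (m + 2) +
      6 * ((-1) ^ (m + 4) * X ^ (m + 4)) * ((m : ℚ[X]) + 2 - X)) * h3
  rw [h]
  simp only [map_smul, map_add, map_sub, unitIntegral_X_pow, unitIntegral_one_sub_X_pow,
    smul_eq_mul]
  push_cast
  ring

end

open scoped Classical in
theorem card_transitive_pairs_eq_sum {α : Type*} [Fintype α] [DecidableEq α]
    (P : Perm α → Prop) :
    (#{p : Perm α × Perm α | p.1.IsTransitive ∧ p.2.IsTransitive ∧ P (p.1 * p.2)} : ℚ) =
      ∑ w with P w, w.factorizationCount := by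
  simp only [Perm.factorizationCount, Perm.transitiveIndicator]
  rw [sum_comm, Finset.card_filter, Nat.cast_sum, Fintype.sum_prod_type]
  refine sum_congr rfl fun u _ => ?_
  rw [sum_filter]
  conv_rhs => rw [← Equiv.sum_comp (Equiv.mulLeft u)]
  refine sum_congr rfl fun v _ => ?_
  by_cases h1 : u.IsTransitive <;> by_cases h2 : v.IsTransitive <;> by_cases h3 : P (u * v) <;>
    simp [h1, h2, h3]

noncomputable section
attribute [local instance] Classical.propDecidable

theorem prob_same_cycle_three (n : ℕ) (hn : 3 ≤ n) :
    ((Finset.univ.filter (fun p : Perm (Fin n) × Perm (Fin n) =>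
        (p.1.IsCycle ∧ p.1.support = Finset.univ) ∧
        (p.2.IsCycle ∧ p.2.support = Finset.univ) ∧
        (p.1 * p.2).SameCycle ⟨0, by omega⟩ ⟨1, by omega⟩ ∧
        (p.1 * p.2).SameCycle ⟨0, by omega⟩ ⟨2, by omega⟩)).card : ℚ) =
      ((n - 1).factorial : ℚ) ^ 2 *
        (if Odd n then 1 / 3 + 1 / (((n : ℚ) - 2) * ((n : ℚ) + 3))
         else 1 / 3 - 3 / (((n : ℚ) - 1) * ((n : ℚ) + 2))) := by
  obtain ⟨m, rfl⟩ := Nat.exists_eq_add_of_le' hn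
  have hcount := card_transitive_pairs_eq_sum (fun w : Perm (Fin (m + 3)) =>
    w.SameCycle ⟨0, by omega⟩ ⟨1, by omega⟩ ∧ w.SameCycle ⟨0, by omega⟩ ⟨2, by omega⟩)
  have hI := unitIntegral_sameCycleSum_fin m
  rw [sameCycleSum, map_sum] at hI
  have hfac : ((m + 2).factorial : ℚ) = (m + 2) * (m + 1) * m.factorial := by
    simp [Nat.factorial_succ]
    ring
  simp only [Perm.isTransitive_iff] at hcount
  trans ((m + 2).factorial : ℚ) * ((m.factorial : ℚ) / 3 * ((m + 1) * (m + 2) *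
      ((m + 3) / (m + 4) + m * (1 / (m + 3) - 1 / (m + 4))) +
      6 * (1 / (m + 3) - 3 / (m + 4) + 3 / (m + 5) - 1 / (m + 6)) +
      6 * (-1) ^ m * ((m + 2) / (m + 5) - 1 / (m + 6))))
  · rw [← hI, mul_sum]
    have hN : ∀ w : Perm (Fin (m + 3)), _ := Perm.factorizationCount_eq (m + 2)
    simp only [hN] at hcount
    convert hcount
  · have e3 : m + 3 - 1 = m + 2 := rfl
    rw [e3, hfac]
    push_cast
    have h1 : (m : ℚ) + 3 - 2 = m + 1 := by ring
    have h2 : (m : ℚ) + 3 - 1 = m + 2 := by ring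
    have h3 : (m : ℚ) + 3 + 3 = m + 6 := by ring
    have h4 : (m : ℚ) + 3 + 2 = m + 5 := by ring
    rw [h1, h2, h3, h4]
    rcases Nat.even_or_odd m with hm | hm
    · have ho : Odd (m + 3) := hm.add_odd (by decide)
      rw [if_pos ho, hm.neg_one_pow]
      field_simp
      ring
    · have ho : ¬ Odd (m + 3) := Nat.not_odd_iff_even.2 (hm.add_odd (by decide))
      rw [if_neg ho, hm.neg_one_pow]
      field_simp
      ring
end
end
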